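/- Let S be an m×n random matrix whose columns are i.i.d. uniformly distributed on the unit sphere S^{m−1} in R^m. Then for each t ≥ 0, P(‖S‖ ≥ (√n + √m + t)/√(m − 0.5)) ≤ 1.5 e^{−t²/2}, where ‖·‖ is the spectral norm. -/

import Mathlib

open MeasureTheory ProbabilityTheory

/-- The standard Gaussian measure `N(0, I_m)` on `ℝ^m`. -/
noncomputable def stdGaussian (m : ℕ) : Measure (Fin m → ℝ) :=
  Measure.pi fun _ => gaussianReal 0 1

/-- The Euclidean norm of a vector in `ℝ^m`. -/
noncomputable def euclNorm {m : ℕ} (x : Fin m → ℝ) : ℝ :=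
  Real.sqrt (∑ i, x i ^ 2)

/-- The uniform distribution on the unit sphere `S^{m−1} ⊆ ℝ^m`, realized as
the law of `g / ‖g‖` for `g` a standard Gaussian vector. -/
noncomputable def uniformSphere (m : ℕ) : Measure (Fin m → ℝ) :=
  Measure.map (fun x => (euclNorm x)⁻¹ • x) (stdGaussian m)

/-- The spectral norm of an `m × n` matrix given by its columns
`S : Fin n → ℝ^m`, namely `sup_{‖u‖=1} ‖S u‖`. -/
noncomputable def specNorm {m n : ℕ} (S : Fin n → Fin m → ℝ) : ℝ :=
  sSup {r : ℝ | ∃ u : Fin n → ℝ, euclNorm u = 1 ∧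
        r = euclNorm (fun i => ∑ j, S j i * u j)}

open scoped ENNReal

section GaussianPi

variable {κ : Type*} [Fintype κ]

/-- The unnormalised density of the standard Gaussian measure on `κ → ℝ`. -/
noncomputable def gaussWeight (x : κ → ℝ) : ℝ := Real.exp (-(∑ k, x k ^ 2) / 2)

lemma pi_withDensity_ofReal {p : ℝ → ℝ} (hp : Integrable p) (hp0 : ∀ x, 0 ≤ p x)
    [SigmaFinite (volume.withDensity fun x => ENNReal.ofReal (p x))] :
    Measure.pi (fun _ : κ => volume.withDensity fun x => ENNReal.ofReal (p x)) =
      (volume : Measure (κ → ℝ)).withDensity (fun x => ENNReal.ofReal (∏ k, p (x k))) := by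
  classical
  refine (Measure.pi_eq fun s hs => ?_)
  have hi : ∀ k, Integrable ((s k).indicator p) := fun k => hp.indicator (hs k)
  have hi0 : ∀ k x, 0 ≤ (s k).indicator p x := fun k x => Set.indicator_nonneg (fun y _ => hp0 y) x
  have hind : (fun x : κ → ℝ => (Set.univ.pi s).indicator
      (fun x => ENNReal.ofReal (∏ k, p (x k))) x) =
      fun x => ENNReal.ofReal (∏ k, (s k).indicator p (x k)) := by
    funext x
    by_cases hx : x ∈ Set.univ.pi s
    · rw [Set.indicator_of_mem hx]
      congr 1
      exact Finset.prod_congr rfl fun k _ => (Set.indicator_of_mem (hx k trivial) _).symm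
    · rw [Set.indicator_of_notMem hx]
      simp only [Set.mem_pi, Set.mem_univ, true_implies, not_forall] at hx
      obtain ⟨k, hk⟩ := hx
      rw [Finset.prod_eq_zero (Finset.mem_univ k) (Set.indicator_of_notMem hk _),
        ENNReal.ofReal_zero]
  rw [withDensity_apply _ (MeasurableSet.univ_pi hs),
    ← lintegral_indicator (MeasurableSet.univ_pi hs), hind,
    volume_pi, ← ofReal_integral_eq_lintegral_ofReal (Integrable.fintype_prod_dep hi)
      (ae_of_all _ fun x => Finset.prod_nonneg fun k _ => hi0 k _),
    ← volume_pi, integral_fintype_prod_volume_eq_prod (fun k => (s k).indicator p),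
    ENNReal.ofReal_prod_of_nonneg fun k _ => integral_nonneg (hi0 k)]
  refine Finset.prod_congr rfl fun k _ => ?_
  rw [withDensity_apply _ (hs k), ← lintegral_indicator (hs k),
    ofReal_integral_eq_lintegral_ofReal (hi k) (ae_of_all _ (hi0 k))]
  refine lintegral_congr fun x => ?_
  by_cases hx : x ∈ s k <;> simp [hx]

lemma pi_gaussianReal_eq_withDensity :
    Measure.pi (fun _ : κ => gaussianReal 0 1) =
      (volume : Measure (κ → ℝ)).withDensity fun x =>
        ENNReal.ofReal ((Real.sqrt (2 * Real.pi))⁻¹ ^ Fintype.card κ * gaussWeight x) := by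
  have h1 : gaussianReal 0 1 =
      volume.withDensity fun x => ENNReal.ofReal (gaussianPDFReal 0 1 x) :=
    gaussianReal_of_var_ne_zero _ one_ne_zero
  have h2 : SigmaFinite (volume.withDensity fun x => ENNReal.ofReal (gaussianPDFReal 0 1 x)) := by
    rw [← h1]; infer_instance
  rw [h1, pi_withDensity_ofReal (integrable_gaussianPDFReal 0 1) (gaussianPDFReal_nonneg 0 1)]
  congr 1
  funext x
  simp only [gaussianPDFReal, Finset.prod_mul_distrib, ← Real.exp_sum, gaussWeight]
  simp [Finset.sum_div, neg_div]

lemma integrable_exp_mul_sum_abs (K : ℝ) :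
    Integrable (fun x : κ → ℝ => Real.exp (K * ∑ k, |x k|))
      (Measure.pi fun _ : κ => gaussianReal 0 1) := by
  have h : Integrable (fun x : ℝ => Real.exp (K * |x|)) (gaussianReal 0 1) := by
    refine ((integrable_exp_mul_gaussianReal K).add (integrable_exp_mul_gaussianReal (-K))).mono'
      (by fun_prop) (ae_of_all _ fun x => ?_)
    rw [Real.norm_of_nonneg (Real.exp_pos _).le]
    simp only [Pi.add_apply]
    rcases abs_cases x with ⟨h, _⟩ | ⟨h, _⟩ <;> rw [h]
    · linarith [Real.exp_pos (-K * x)]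
    · rw [show K * -x = -K * x by ring]
      linarith [Real.exp_pos (K * x)]
  have := Integrable.fintype_prod (ι := κ) (μ := fun _ => gaussianReal 0 1) (fun _ => h)
  simpa [Finset.mul_sum, Real.exp_sum] using this

/-- A function bounded by `C exp (K ∑ |x_k|)`. -/
def ExpBounded (f : (κ → ℝ) → ℝ) : Prop :=
  ∃ C K : ℝ, 0 ≤ C ∧ 0 ≤ K ∧ ∀ x, |f x| ≤ C * Real.exp (K * ∑ k, |x k|)

lemma ExpBounded.integrable {f : (κ → ℝ) → ℝ} (hf : ExpBounded f) (hm : Measurable f) :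
    Integrable f (Measure.pi fun _ : κ => gaussianReal 0 1) := by
  obtain ⟨C, K, -, -, h⟩ := hf
  exact ((integrable_exp_mul_sum_abs K).const_mul C).mono' hm.aestronglyMeasurable
    (ae_of_all _ h)

lemma ExpBounded.mono {f g : (κ → ℝ) → ℝ} (hg : ExpBounded g) (h : ∀ x, |f x| ≤ |g x|) :
    ExpBounded f := by
  obtain ⟨C, K, hC, hK, h'⟩ := hg
  exact ⟨C, K, hC, hK, fun x => (h x).trans (h' x)⟩

lemma ExpBounded.mul {f g : (κ → ℝ) → ℝ} (hf : ExpBounded f) (hg : ExpBounded g) :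
    ExpBounded fun x => f x * g x := by
  obtain ⟨C, K, hC, hK, h⟩ := hf
  obtain ⟨C', K', hC', hK', h'⟩ := hg
  refine ⟨C * C', K + K', by positivity, by positivity, fun x => ?_⟩
  rw [abs_mul, add_mul, Real.exp_add]
  calc |f x| * |g x| ≤ _ := mul_le_mul (h x) (h' x) (abs_nonneg _) (by positivity)
    _ = _ := by ring

lemma ExpBounded.add {f g : (κ → ℝ) → ℝ} (hf : ExpBounded f) (hg : ExpBounded g) :
    ExpBounded fun x => f x + g x := by
  obtain ⟨C, K, hC, hK, h⟩ := hf
  obtain ⟨C', K', hC', hK', h'⟩ := hg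
  refine ⟨C + C', K + K', by positivity, by positivity, fun x => ?_⟩
  have hS : 0 ≤ ∑ k, |x k| := Finset.sum_nonneg fun _ _ => abs_nonneg _
  have e1 : Real.exp (K * ∑ k, |x k|) ≤ Real.exp ((K + K') * ∑ k, |x k|) :=
    Real.exp_le_exp.2 (by nlinarith [mul_nonneg hK' hS])
  have e2 : Real.exp (K' * ∑ k, |x k|) ≤ Real.exp ((K + K') * ∑ k, |x k|) :=
    Real.exp_le_exp.2 (by nlinarith [mul_nonneg hK hS])
  calc |f x + g x| ≤ |f x| + |g x| := abs_add_le _ _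
    _ ≤ _ := by
      rw [add_mul]
      exact add_le_add ((h x).trans (mul_le_mul_of_nonneg_left e1 hC))
        ((h' x).trans (mul_le_mul_of_nonneg_left e2 hC'))

lemma ExpBounded.const (c : ℝ) : ExpBounded fun _ : κ → ℝ => c :=
  ⟨|c|, 0, abs_nonneg _, le_rfl, fun x => by simp⟩

lemma expBounded_sum_abs : ExpBounded fun x : κ → ℝ => ∑ k, |x k| :=
  ⟨1, 1, by norm_num, by norm_num, fun x => by
    rw [abs_of_nonneg (Finset.sum_nonneg fun _ _ => abs_nonneg _)]
    linarith [Real.add_one_le_exp (1 * ∑ k, |x k|)]⟩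

lemma abs_sum_mul_le (v x : κ → ℝ) : |∑ k, v k * x k| ≤ (∑ k, |v k|) * ∑ k, |x k| := by
  rw [Finset.sum_mul]
  refine (Finset.abs_sum_le_sum_abs _ _).trans (Finset.sum_le_sum fun k _ => ?_)
  rw [abs_mul]
  exact mul_le_mul_of_nonneg_left
    (Finset.single_le_sum (f := fun k => |x k|) (fun _ _ => abs_nonneg _) (Finset.mem_univ k))
    (abs_nonneg _)

lemma expBounded_linear (v : κ → ℝ) : ExpBounded fun x : κ → ℝ => ∑ k, v k * x k :=
  ((ExpBounded.const (∑ k, |v k|)).mul expBounded_sum_abs).mono fun x => by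
    refine (abs_sum_mul_le v x).trans (le_abs_self _)

/-- Gaussian integration by parts. -/
lemma gaussian_integral_by_parts {f f' : (κ → ℝ) → ℝ} (v : κ → ℝ)
    (hf : ExpBounded f) (hf' : ExpBounded f') (hm : Measurable f) (hm' : Measurable f')
    (hd : ∀ x, HasLineDerivAt ℝ f (f' x) x v) :
    ∫ x, (∑ k, v k * x k) * f x ∂(Measure.pi fun _ : κ => gaussianReal 0 1) =
      ∫ x, f' x ∂(Measure.pi fun _ : κ => gaussianReal 0 1) := by
  set c : ℝ := (Real.sqrt (2 * Real.pi))⁻¹ ^ Fintype.card κ with hc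
  have hc0 : 0 < c := by positivity
  have hwc : Continuous (gaussWeight : (κ → ℝ) → ℝ) := by unfold gaussWeight; fun_prop
  have hw0 : ∀ x : κ → ℝ, 0 ≤ c * gaussWeight x := fun x =>
    mul_nonneg hc0.le (Real.exp_pos _).le
  have key : ∀ g : (κ → ℝ) → ℝ, ∫ x, g x ∂(Measure.pi fun _ : κ => gaussianReal 0 1) =
      ∫ x, g x * (c * gaussWeight x) := fun g => by
    rw [pi_gaussianReal_eq_withDensity, integral_withDensity_eq_integral_toReal_smul
      (by fun_prop) (by simp)]
    refine integral_congr_ae (ae_of_all _ fun x => ?_)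
    simp only [← hc]
    rw [ENNReal.toReal_ofReal (hw0 x), smul_eq_mul, mul_comm]
  have keyI : ∀ g : (κ → ℝ) → ℝ, ExpBounded g → Measurable g →
      Integrable fun x => g x * (c * gaussWeight x) := fun g hg hgm => by
    have := hg.integrable hgm
    rw [pi_gaussianReal_eq_withDensity, integrable_withDensity_iff_integrable_smul'
      (by fun_prop) (by simp)] at this
    refine this.congr (ae_of_all _ fun x => ?_)
    simp only [← hc]
    rw [ENNReal.toReal_ofReal (hw0 x), smul_eq_mul, mul_comm]
  have hlm : Measurable fun x : κ → ℝ => ∑ k, v k * x k := by fun_prop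
  have hwd : ∀ x : κ → ℝ, HasLineDerivAt ℝ (fun x => c * gaussWeight x)
      (-((∑ k, v k * x k) * (c * gaussWeight x))) x v := fun x => by
    unfold HasLineDerivAt gaussWeight
    have h1 : HasDerivAt (fun t : ℝ => ∑ k, ((x + t • v) k) ^ 2) (∑ k, 2 * (v k * x k)) 0 := by
      refine HasDerivAt.fun_sum fun k _ => ?_
      have : HasDerivAt (fun t : ℝ => x k + t * v k) (v k) 0 := by
        simpa using ((hasDerivAt_id (0 : ℝ)).mul_const (v k)).const_add (x k)
      refine (this.fun_pow 2).congr_deriv ?_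
      simp
      ring
    refine ((h1.neg.div_const 2).exp.const_mul c).congr_deriv ?_
    simp only [zero_smul, add_zero, Pi.neg_apply, ← Finset.mul_sum]
    ring
  have := integral_bilinear_hasLineDerivAt_right_eq_neg_left_of_integrable
    (μ := (volume : Measure (κ → ℝ))) (B := ContinuousLinearMap.mul ℝ ℝ) (v := v)
    (f := f) (f' := f') (g := fun x => c * gaussWeight x)
    (g' := fun x => -((∑ k, v k * x k) * (c * gaussWeight x)))
    (by simpa using keyI f' hf' hm')
    (by
      have := (keyI _ ((expBounded_linear v).mul hf) (hlm.mul hm)).neg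
      refine this.congr (ae_of_all _ fun x => ?_)
      simp only [Pi.neg_apply, ContinuousLinearMap.mul_apply']
      ring)
    (by simpa using keyI f hf hm) (fun x _ => hd x) (fun x _ => hwd x)
  simp only [ContinuousLinearMap.mul_apply', mul_neg, integral_neg, neg_inj] at this
  rw [key, key, ← this]
  refine integral_congr_ae (ae_of_all _ fun x => ?_)
  ring

end GaussianPi

section Softmax

variable {ι : Type*} [Fintype ι]

/-- The power `α` of the exponential sum `∑ exp (β z_i)`. -/
noncomputable def softPow (α β : ℝ) (z : ι → ℝ) : ℝ := (∑ i, Real.exp (β * z i)) ^ α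

/-- The partial derivatives of `softPow`. -/
noncomputable def softGrad (α β : ℝ) (i : ι) (z : ι → ℝ) : ℝ :=
  α * β * Real.exp (β * z i) * softPow (α - 1) β z

/-- The derivative of `softGrad α β i` in the direction `w`. -/
noncomputable def softHess (α β : ℝ) (i : ι) (w z : ι → ℝ) : ℝ :=
  α * β ^ 2 * (Real.exp (β * z i) * softPow (α - 1) β z) * w i +
    α * β ^ 2 * (α - 1) * (∑ j, Real.exp (β * z i) * Real.exp (β * z j) *
      softPow (α - 2) β z * w j)

lemma exp_le_softPow {α β : ℝ} (hα : 0 ≤ α) (z : ι → ℝ) (i : ι) :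
    Real.exp (α * β * z i) ≤ softPow α β z := by
  have : Real.exp (β * z i) ≤ ∑ i, Real.exp (β * z i) :=
    Finset.single_le_sum (f := fun i => Real.exp (β * z i)) (fun _ _ => (Real.exp_pos _).le)
      (Finset.mem_univ i)
  refine le_trans (le_of_eq ?_) (Real.rpow_le_rpow (Real.exp_pos _).le this hα)
  rw [← Real.exp_mul]
  ring_nf

variable [Nonempty ι]

lemma sum_exp_pos (β : ℝ) (z : ι → ℝ) : 0 < ∑ i, Real.exp (β * z i) :=
  Finset.sum_pos (fun _ _ => Real.exp_pos _) Finset.univ_nonempty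

lemma softPow_pos (α β : ℝ) (z : ι → ℝ) : 0 < softPow α β z :=
  Real.rpow_pos_of_pos (sum_exp_pos β z) _

lemma sum_exp_mul_softPow (α β : ℝ) (z : ι → ℝ) :
    (∑ i, Real.exp (β * z i)) * softPow (α - 1) β z = softPow α β z := by
  rw [softPow, softPow, Real.rpow_sub_one (sum_exp_pos β z).ne',
    mul_div_cancel₀ _ (sum_exp_pos β z).ne']

lemma continuous_softPow (α β : ℝ) : Continuous (softPow α β : (ι → ℝ) → ℝ) := by
  unfold softPow
  exact Continuous.rpow_const (by fun_prop) fun z => Or.inl (sum_exp_pos β z).ne'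

lemma continuous_softGrad (α β : ℝ) (i : ι) : Continuous (softGrad α β i) := by
  have := continuous_softPow (ι := ι) (α - 1) β
  unfold softGrad
  fun_prop

lemma continuous_softHess (α β : ℝ) (i : ι) (w : ι → ℝ) : Continuous (softHess α β i w) := by
  have := continuous_softPow (ι := ι) (α - 1) β
  have := continuous_softPow (ι := ι) (α - 2) β
  unfold softHess
  fun_prop

lemma exp_mul_softPow_le (α β : ℝ) (i : ι) (z : ι → ℝ) :
    Real.exp (β * z i) * softPow (α - 1) β z ≤ softPow α β z := by
  rw [← sum_exp_mul_softPow α]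
  exact mul_le_mul_of_nonneg_right
    (Finset.single_le_sum (f := fun i => Real.exp (β * z i)) (fun _ _ => (Real.exp_pos _).le)
      (Finset.mem_univ i)) (softPow_pos _ _ _).le

lemma exp_mul_exp_mul_softPow_le (α β : ℝ) (i j : ι) (z : ι → ℝ) :
    Real.exp (β * z i) * Real.exp (β * z j) * softPow (α - 2) β z ≤ softPow α β z := by
  have h := exp_mul_softPow_le (α - 1) β j z
  rw [show α - 1 - 1 = α - 2 by ring] at h
  rw [mul_assoc]
  exact (mul_le_mul_of_nonneg_left h (Real.exp_pos _).le).trans (exp_mul_softPow_le α β i z)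

lemma abs_softGrad_le {α β : ℝ} (hα : 0 ≤ α) (hβ : 0 ≤ β) (i : ι) (z : ι → ℝ) :
    |softGrad α β i z| ≤ α * β * softPow α β z := by
  have h0 : 0 ≤ softGrad α β i z := by
    have := softPow_pos (α - 1) β z
    unfold softGrad
    positivity
  rw [abs_of_nonneg h0, softGrad, mul_assoc (α * β)]
  exact mul_le_mul_of_nonneg_left (exp_mul_softPow_le α β i z) (by positivity)

lemma abs_softHess_le {α β : ℝ} (hα : 0 ≤ α) (hα1 : α ≤ 1) (i : ι) (w z : ι → ℝ) :
    |softHess α β i w z| ≤ α * β ^ 2 * (|w i| + ∑ j, |w j|) * softPow α β z := by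
  have h1 : |α * β ^ 2 * (Real.exp (β * z i) * softPow (α - 1) β z) * w i| ≤
      α * β ^ 2 * |w i| * softPow α β z := by
    have := softPow_pos (α - 1) β z
    rw [abs_mul, abs_of_nonneg (by positivity)]
    calc _ = α * β ^ 2 * |w i| * (Real.exp (β * z i) * softPow (α - 1) β z) := by ring
      _ ≤ _ := mul_le_mul_of_nonneg_left (exp_mul_softPow_le α β i z) (by positivity)
  have h2 : |∑ j, Real.exp (β * z i) * Real.exp (β * z j) * softPow (α - 2) β z * w j| ≤
      (∑ j, |w j|) * softPow α β z := by
    rw [Finset.sum_mul]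
    refine (Finset.abs_sum_le_sum_abs _ _).trans (Finset.sum_le_sum fun j _ => ?_)
    have := softPow_pos (α - 2) β z
    rw [abs_mul, abs_of_nonneg (by positivity), mul_comm]
    exact mul_le_mul_of_nonneg_left (exp_mul_exp_mul_softPow_le α β i j z) (abs_nonneg _)
  have h3 : |α - 1| ≤ 1 := abs_le.2 ⟨by linarith, by linarith⟩
  unfold softHess
  refine (abs_add_le _ _).trans ?_
  rw [abs_mul (α * β ^ 2 * (α - 1)), abs_mul (α * β ^ 2), abs_of_nonneg (by positivity : 0 ≤ α * β ^ 2)]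
  have h4 : α * β ^ 2 * |α - 1| *
      |∑ j, Real.exp (β * z i) * Real.exp (β * z j) * softPow (α - 2) β z * w j| ≤
      α * β ^ 2 * 1 * ((∑ j, |w j|) * softPow α β z) := by gcongr
  linarith

lemma le_sum_softHess {α β : ℝ} (hα : 0 ≤ α) (hα1 : α ≤ 1) (D : ι → ι → ℝ)
    (hD : ∀ i j, D i j ≤ 1) (hDi : ∀ i, D i i = 1) (z : ι → ℝ) :
    (α * β) ^ 2 * softPow α β z ≤ ∑ i, softHess α β i (D i) z := by
  have h2 : ∀ i, α * β ^ 2 * (Real.exp (β * z i) * softPow (α - 1) β z) +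
      α * β ^ 2 * (α - 1) * (Real.exp (β * z i) * softPow (α - 1) β z) ≤
        softHess α β i (D i) z := fun i => by
    unfold softHess
    rw [hDi, mul_one]
    refine add_le_add_right (mul_le_mul_of_nonpos_left ?_ ?_) _
    · have : softPow (α - 1) β z = (∑ j, Real.exp (β * z j)) * softPow (α - 2) β z := by
        rw [← sum_exp_mul_softPow (α - 1)]; ring_nf
      rw [this, ← mul_assoc, Finset.mul_sum, Finset.sum_mul]
      refine Finset.sum_le_sum fun j _ => ?_
      have := softPow_pos (α - 2) β z
      exact mul_le_of_le_one_right (by positivity) (hD i j)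
    · exact mul_nonpos_of_nonneg_of_nonpos (by positivity) (by linarith)
  refine le_trans (le_of_eq ?_) (Finset.sum_le_sum fun i _ => h2 i)
  rw [Finset.sum_add_distrib, ← Finset.mul_sum, ← Finset.mul_sum, ← Finset.sum_mul,
    sum_exp_mul_softPow]
  ring

lemma hasDerivAt_softPow (α β : ℝ) {z : ℝ → ι → ℝ} {z' : ι → ℝ} {t : ℝ}
    (hz : ∀ i, HasDerivAt (fun s => z s i) (z' i) t) :
    HasDerivAt (fun s => softPow α β (z s)) (∑ i, softGrad α β i (z t) * z' i) t := by
  have h : HasDerivAt (fun s => ∑ i, Real.exp (β * z s i))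
      (∑ i, Real.exp (β * z t i) * (β * z' i)) t :=
    HasDerivAt.fun_sum fun i _ => ((hz i).const_mul β).exp
  refine (h.rpow_const (p := α) (Or.inl (sum_exp_pos β _).ne')).congr_deriv ?_
  simp only [softGrad, softPow, Finset.sum_mul]
  exact Finset.sum_congr rfl fun i _ => by ring

lemma hasDerivAt_softGrad (α β : ℝ) (i : ι) {z : ℝ → ι → ℝ} {z' : ι → ℝ} {t : ℝ}
    (hz : ∀ i, HasDerivAt (fun s => z s i) (z' i) t) :
    HasDerivAt (fun s => softGrad α β i (z s)) (softHess α β i z' (z t)) t := by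
  refine ((((hz i).const_mul β).exp.const_mul (α * β)).mul
    (hasDerivAt_softPow (α - 1) β hz)).congr_deriv ?_
  simp only [softGrad, softHess, Finset.mul_sum, show α - 1 - 1 = α - 2 by ring]
  congr 1
  · ring
  · exact Finset.sum_congr rfl fun j _ => by ring

lemma softPow_le_of_le {α β B : ℝ} (hα : 0 ≤ α) (hβ : 0 ≤ β) {z : ι → ℝ}
    (hz : ∀ i, z i ≤ B) :
    softPow α β z ≤ (Fintype.card ι : ℝ) ^ α * Real.exp (α * β * B) := by
  have : ∑ i, Real.exp (β * z i) ≤ Fintype.card ι * Real.exp (β * B) := by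
    refine (Finset.sum_le_sum (g := fun _ => Real.exp (β * B)) fun i _ =>
      Real.exp_le_exp.2 (mul_le_mul_of_nonneg_left (hz i) hβ)).trans (by simp)
  refine (Real.rpow_le_rpow (sum_exp_pos β z).le this hα).trans ?_
  rw [Real.mul_rpow (by positivity) (Real.exp_pos _).le, ← Real.exp_mul]
  ring_nf
  rfl

end Softmax

section Comparison

variable {ι κ : Type*} [Fintype ι] [Fintype κ] [Nonempty ι]

lemma exists_softPow_linear_le {α β : ℝ} (hα : 0 ≤ α) (hβ : 0 ≤ β) (M : ℝ) (hM : 0 ≤ M) :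
    ∃ C K : ℝ, 0 ≤ C ∧ 0 ≤ K ∧ ∀ (z : ι → ℝ) (x : κ → ℝ), (∀ i, |z i| ≤ M * ∑ k, |x k|) →
      softPow α β z ≤ C * Real.exp (K * ∑ k, |x k|) := by
  refine ⟨(Fintype.card ι : ℝ) ^ α, α * β * M, by positivity, by positivity, fun z x hz => ?_⟩
  rw [mul_assoc]
  exact softPow_le_of_le hα hβ fun i => (le_abs_self _).trans (hz i)

/-- The line derivative of a linear map. -/
lemma hasDerivAt_linear_line (c v x : κ → ℝ) :
    HasDerivAt (fun s : ℝ => ∑ k, c k * (x + s • v) k) (∑ k, c k * v k) 0 := by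
  refine HasDerivAt.fun_sum fun k _ => HasDerivAt.const_mul _ ?_
  simpa using ((hasDerivAt_id (0 : ℝ)).mul_const (v k)).const_add (x k)

lemma expBounded_softPow_linear {α β : ℝ} (hα : 0 ≤ α) (hβ : 0 ≤ β) (c : ι → κ → ℝ) :
    ExpBounded fun x : κ → ℝ => softPow α β fun i => ∑ k, c i k * x k := by
  obtain ⟨C, K, hC, hK, h⟩ := exists_softPow_linear_le (ι := ι) (κ := κ) hα hβ
    (∑ i, ∑ k, |c i k|) (Finset.sum_nonneg fun _ _ => Finset.sum_nonneg fun _ _ => abs_nonneg _)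
  refine ⟨C, K, hC, hK, fun x => ?_⟩
  rw [abs_of_pos (softPow_pos _ _ _)]
  refine h _ _ fun i => (abs_sum_mul_le _ _).trans ?_
  exact mul_le_mul_of_nonneg_right
    (Finset.single_le_sum (f := fun i => ∑ k, |c i k|)
      (fun _ _ => Finset.sum_nonneg fun _ _ => abs_nonneg _) (Finset.mem_univ i))
    (Finset.sum_nonneg fun _ _ => abs_nonneg _)

lemma integral_linear_mul_softGrad {α β : ℝ} (hα : 0 ≤ α) (hα1 : α ≤ 1) (hβ : 0 ≤ β)
    (c : ι → κ → ℝ) (v : κ → ℝ) (i : ι) :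
    Integrable (fun x => (∑ k, v k * x k) * softGrad α β i fun j => ∑ k, c j k * x k)
      (Measure.pi fun _ : κ => gaussianReal 0 1) ∧
    Integrable (fun x => softHess α β i (fun j => ∑ k, c j k * v k) fun j => ∑ k, c j k * x k)
      (Measure.pi fun _ : κ => gaussianReal 0 1) ∧
    ∫ x, (∑ k, v k * x k) * softGrad α β i (fun j => ∑ k, c j k * x k)
        ∂(Measure.pi fun _ : κ => gaussianReal 0 1) =
      ∫ x, softHess α β i (fun j => ∑ k, c j k * v k) (fun j => ∑ k, c j k * x k)
        ∂(Measure.pi fun _ : κ => gaussianReal 0 1) := by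
  have hlin : Continuous fun (x : κ → ℝ) (j : ι) => ∑ k, c j k * x k := by fun_prop
  have hg : ExpBounded fun x : κ → ℝ => softGrad α β i fun j => ∑ k, c j k * x k :=
    ((ExpBounded.const (α * β)).mul (expBounded_softPow_linear hα hβ c)).mono fun x =>
      (abs_softGrad_le hα hβ i _).trans (le_abs_self _)
  have hh : ExpBounded fun x : κ → ℝ =>
      softHess α β i (fun j => ∑ k, c j k * v k) fun j => ∑ k, c j k * x k :=
    ((ExpBounded.const _).mul (expBounded_softPow_linear hα hβ c)).mono fun x =>
      (abs_softHess_le hα hα1 i _ _).trans (le_abs_self _)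
  have hgm := ((continuous_softGrad α β i).comp hlin).measurable
  have hhm := ((continuous_softHess α β i fun j => ∑ k, c j k * v k).comp hlin).measurable
  refine ⟨((expBounded_linear v).mul hg).integrable (.mul (by fun_prop) hgm),
    hh.integrable hhm, gaussian_integral_by_parts v hg hh hgm hhm fun x => ?_⟩
  have := hasDerivAt_softGrad α β i (t := 0)
    (z := fun (s : ℝ) j => ∑ k, c j k * (x + s • v) k) fun j => hasDerivAt_linear_line (c j) v x
  simpa [HasLineDerivAt] using this

/-- **Slepian-type comparison** of the exponential functional of two Gaussian processes with
orthogonal coefficients, where the covariances differ by at most one, and by exactly one on the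
diagonal. -/
theorem softPow_gaussian_comparison {α β : ℝ} (hα : 0 ≤ α) (hα1 : α ≤ 1) (hβ : 0 ≤ β)
    (a b : ι → κ → ℝ) (hab : ∀ i j, ∑ k, a i k * b j k = 0)
    (hD : ∀ i j, ∑ k, b i k * b j k - ∑ k, a i k * a j k ≤ 1)
    (hDi : ∀ i, ∑ k, b i k * b i k - ∑ k, a i k * a i k = 1) :
    Real.exp ((α * β) ^ 2 / 2) *
        ∫ x, softPow α β (fun i => ∑ k, a i k * x k) ∂(Measure.pi fun _ : κ => gaussianReal 0 1) ≤
      ∫ x, softPow α β (fun i => ∑ k, b i k * x k)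
        ∂(Measure.pi fun _ : κ => gaussianReal 0 1) := by
  set γ := Measure.pi fun _ : κ => gaussianReal 0 1 with hγ
  set c : ℝ → ι → κ → ℝ := fun θ i k => Real.cos θ * a i k + Real.sin θ * b i k with hc
  set c' : ℝ → ι → κ → ℝ := fun θ i k => -Real.sin θ * a i k + Real.cos θ * b i k with hc'
  set D : ι → ι → ℝ := fun i j => ∑ k, b i k * b j k - ∑ k, a i k * a j k with hDdef
  have hcc : ∀ θ i j, ∑ k, c θ j k * c' θ i k = Real.sin θ * Real.cos θ * D i j := fun θ i j => by
    have h1 := hab j i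
    have h2 := hab i j
    have : ∀ k, c θ j k * c' θ i k = Real.sin θ * Real.cos θ * (b i k * b j k - a i k * a j k) +
        Real.cos θ ^ 2 * (a j k * b i k) - Real.sin θ ^ 2 * (a i k * b j k) := fun k => by
      simp only [hc, hc']; ring
    simp only [this, Finset.sum_add_distrib, Finset.sum_sub_distrib, ← Finset.mul_sum, h1, h2, hDdef]
    ring
  have hlin : ∀ θ, Continuous fun (x : κ → ℝ) (j : ι) => ∑ k, c θ j k * x k := fun θ => by fun_prop
  set M : ℝ := ∑ i, ∑ k, (|a i k| + |b i k|) with hM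
  have hM0 : 0 ≤ M := by positivity
  have hMi : ∀ i, ∑ k, (|a i k| + |b i k|) ≤ M := fun i =>
    Finset.single_le_sum (f := fun i => ∑ k, (|a i k| + |b i k|))
      (fun _ _ => by positivity) (Finset.mem_univ i)
  have hbound : ∀ (s t : ℝ), |s| ≤ 1 → |t| ≤ 1 → ∀ (i : ι) (x : κ → ℝ),
      |∑ k, (s * a i k + t * b i k) * x k| ≤ M * ∑ k, |x k| := fun s t hs ht i x => by
    refine (abs_sum_mul_le _ _).trans (mul_le_mul_of_nonneg_right ?_ (by positivity))
    refine (Finset.sum_le_sum fun k _ => ?_).trans (hMi i)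
    refine (abs_add_le _ _).trans ?_
    rw [abs_mul, abs_mul]
    exact add_le_add (mul_le_of_le_one_left (abs_nonneg _) hs)
      (mul_le_of_le_one_left (abs_nonneg _) ht)
  have hcb : ∀ θ i (x : κ → ℝ), |∑ k, c θ i k * x k| ≤ M * ∑ k, |x k| := fun θ i x =>
    hbound _ _ (Real.abs_cos_le_one θ) (Real.abs_sin_le_one θ) i x
  have hc'b : ∀ θ i (x : κ → ℝ), |∑ k, c' θ i k * x k| ≤ M * ∑ k, |x k| := fun θ i x =>
    hbound _ _ (by rw [abs_neg]; exact Real.abs_sin_le_one θ) (Real.abs_cos_le_one θ) i x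
  obtain ⟨C, K, hC, hK, hCK⟩ := exists_softPow_linear_le (ι := ι) (κ := κ) hα hβ M hM0
  set φ : ℝ → ℝ := fun θ => ∫ x, softPow α β (fun i => ∑ k, c θ i k * x k) ∂γ with hφ
  set φ' : ℝ → ℝ := fun θ =>
    ∫ x, ∑ i, softGrad α β i (fun j => ∑ k, c θ j k * x k) * ∑ k, c' θ i k * x k ∂γ with hφ'
  have hint : ∀ θ, Integrable (fun x => softPow α β (fun i => ∑ k, c θ i k * x k)) γ := fun θ =>
    (expBounded_softPow_linear hα hβ _).integrable
      ((continuous_softPow α β).comp (hlin θ)).measurable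
  have hderiv : ∀ θ, HasDerivAt φ (φ' θ) θ := fun θ => by
    have hb : ExpBounded fun x : κ → ℝ => (Fintype.card ι * (α * β * C) *
        Real.exp (K * ∑ k, |x k|)) * (M * ∑ k, |x k|) :=
      ExpBounded.mul ⟨Fintype.card ι * (α * β * C), K, by positivity, hK, fun x => by
        rw [abs_of_nonneg (by positivity)]⟩ ((ExpBounded.const M).mul expBounded_sum_abs)
    refine (hasDerivAt_integral_of_dominated_loc_of_deriv_le (μ := γ) (s := Set.univ)
      (F := fun θ x => softPow α β fun i => ∑ k, c θ i k * x k)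
      (F' := fun θ x => ∑ i, softGrad α β i (fun j => ∑ k, c θ j k * x k) * ∑ k, c' θ i k * x k)
      (bound := fun x : κ → ℝ => (Fintype.card ι * (α * β * C) *
        Real.exp (K * ∑ k, |x k|)) * (M * ∑ k, |x k|))
      Filter.univ_mem (Filter.Eventually.of_forall fun θ => (hint θ).aestronglyMeasurable) (hint θ)
      (Continuous.aestronglyMeasurable ?_)
      (ae_of_all _ fun x θ _ => ?_) (hb.integrable (by fun_prop))
      (ae_of_all _ fun x θ _ => hasDerivAt_softPow α β fun i => ?_)).2
    · refine continuous_finsetSum _ fun i _ => ?_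
      exact ((continuous_softGrad α β i).comp (hlin θ)).mul (by fun_prop)
    · have hL : 0 ≤ M * ∑ k, |x k| := by positivity
      refine (Finset.abs_sum_le_sum_abs _ _).trans ((Finset.sum_le_sum (g := fun _ =>
        (α * β * C * Real.exp (K * ∑ k, |x k|)) * (M * ∑ k, |x k|)) fun i _ => ?_).trans
          (le_of_eq ?_))
      · rw [abs_mul]
        refine mul_le_mul ((abs_softGrad_le hα hβ i _).trans ?_) (hc'b θ i x) (abs_nonneg _)
          (by positivity)
        rw [mul_assoc (α * β)]
        exact mul_le_mul_of_nonneg_left (hCK _ x fun i => hcb θ i x) (by positivity)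
      · simp
        ring
    · refine HasDerivAt.fun_sum fun k _ => HasDerivAt.mul_const ?_ _
      exact ((Real.hasDerivAt_cos θ).mul_const _).add ((Real.hasDerivAt_sin θ).mul_const _)
  have hφ'_ge : ∀ θ, 0 ≤ Real.sin θ * Real.cos θ →
      Real.sin θ * Real.cos θ * (α * β) ^ 2 * φ θ ≤ φ' θ := fun θ hθ => by
    have h := fun i => integral_linear_mul_softGrad hα hα1 hβ (c θ) (c' θ i) i
    have e : φ' θ = ∫ x, ∑ i, softHess α β i (fun j => ∑ k, c θ j k * c' θ i k)
        (fun j => ∑ k, c θ j k * x k) ∂γ := by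
      simp only [hφ', mul_comm (softGrad α β _ _)]
      rw [integral_finsetSum _ fun i _ => (h i).1, integral_finsetSum _ fun i _ => (h i).2.1]
      exact Finset.sum_congr rfl fun i _ => (h i).2.2
    rw [e, hφ, ← integral_const_mul]
    refine integral_mono ((hint θ).const_mul _) (integrable_finsetSum _ fun i _ => (h i).2.1)
      fun x => ?_
    have hs : ∀ i z, softHess α β i (fun j => ∑ k, c θ j k * c' θ i k) z =
        Real.sin θ * Real.cos θ * softHess α β i (D i) z := fun i z => by
      simp only [hcc, softHess, mul_add, Finset.mul_sum]
      congr 1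
      · ring
      · exact Finset.sum_congr rfl fun j _ => by ring
    simp only [hs, ← Finset.mul_sum, mul_assoc (Real.sin θ * Real.cos θ)]
    exact mul_le_mul_of_nonneg_left (le_sum_softHess hα hα1 D hD hDi _) hθ
  set ψ : ℝ → ℝ := fun θ => Real.exp ((α * β) ^ 2 / 2 * Real.cos θ ^ 2) * φ θ with hψ
  have hψd : ∀ θ, HasDerivAt ψ (Real.exp ((α * β) ^ 2 / 2 * Real.cos θ ^ 2) *
      (φ' θ - Real.sin θ * Real.cos θ * (α * β) ^ 2 * φ θ)) θ := fun θ => by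
    refine ((((Real.hasDerivAt_cos θ).fun_pow 2).const_mul ((α * β) ^ 2 / 2)).exp.mul
      (hderiv θ)).congr_deriv ?_
    push_cast
    ring
  have hmono : MonotoneOn ψ (Set.Icc 0 (Real.pi / 2)) := by
    refine monotoneOn_of_deriv_nonneg (convex_Icc _ _)
      (fun θ _ => (hψd θ).continuousAt.continuousWithinAt)
      (fun θ _ => (hψd θ).differentiableAt.differentiableWithinAt) fun θ hθ => ?_
    rw [interior_Icc] at hθ
    rw [(hψd θ).deriv]
    refine mul_nonneg (Real.exp_pos _).le (sub_nonneg.2 (hφ'_ge θ (mul_nonneg ?_ ?_)))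
    · exact Real.sin_nonneg_of_nonneg_of_le_pi hθ.1.le (by linarith [hθ.2, Real.pi_pos])
    · exact Real.cos_nonneg_of_neg_pi_div_two_le_of_le (by linarith [hθ.1, Real.pi_pos]) hθ.2.le
  have := hmono ⟨le_rfl, by positivity⟩ ⟨by positivity, le_rfl⟩ (by positivity : 0 ≤ Real.pi / 2)
  simpa [hψ, hφ, hc] using this

end Comparison

section NormMgf

variable {κ : Type*} [Fintype κ]

/-- A smooth approximation of the Euclidean norm. -/
noncomputable def regNorm (ε : ℝ) (x : κ → ℝ) : ℝ := Real.sqrt (ε + ∑ k, x k ^ 2)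

lemma continuous_regNorm (ε : ℝ) : Continuous (regNorm ε : (κ → ℝ) → ℝ) := by
  unfold regNorm
  fun_prop

lemma regNorm_pos {ε : ℝ} (hε : 0 < ε) (x : κ → ℝ) : 0 < regNorm ε x :=
  Real.sqrt_pos.2 (by positivity)

lemma sq_regNorm {ε : ℝ} (hε : 0 ≤ ε) (x : κ → ℝ) : regNorm ε x ^ 2 = ε + ∑ k, x k ^ 2 :=
  Real.sq_sqrt (by positivity)

lemma regNorm_le {ε : ℝ} (hε : 0 ≤ ε) (x : κ → ℝ) :
    regNorm ε x ≤ Real.sqrt ε + ∑ k, |x k| := by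
  refine Real.sqrt_le_iff.2 ⟨by positivity, ?_⟩
  have h1 : ∑ k, x k ^ 2 ≤ (∑ k, |x k|) ^ 2 := by
    rw [sq, Finset.sum_mul]
    refine Finset.sum_le_sum fun k _ => ?_
    rw [← sq_abs, sq]
    exact mul_le_mul_of_nonneg_left
      (Finset.single_le_sum (f := fun k => |x k|) (fun _ _ => abs_nonneg _) (Finset.mem_univ k))
      (abs_nonneg _)
  have h2 : 0 ≤ Real.sqrt ε * ∑ k, |x k| := by positivity
  nlinarith [Real.sq_sqrt hε]

lemma expBounded_regNorm {ε : ℝ} (hε : 0 ≤ ε) :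
    ExpBounded (regNorm ε : (κ → ℝ) → ℝ) :=
  ((ExpBounded.const (Real.sqrt ε)).add expBounded_sum_abs).mono fun x => by
    have h0 : 0 ≤ regNorm ε x := Real.sqrt_nonneg _
    rw [abs_of_nonneg h0]
    exact (regNorm_le hε x).trans (le_abs_self _)

lemma expBounded_exp_regNorm {ε : ℝ} (hε : 0 ≤ ε) (t : ℝ) :
    ExpBounded fun x : κ → ℝ => Real.exp (t * regNorm ε x) := by
  refine ⟨Real.exp (|t| * Real.sqrt ε), |t|, by positivity, by positivity, fun x => ?_⟩
  rw [abs_of_pos (Real.exp_pos _), ← Real.exp_add, ← mul_add]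
  refine Real.exp_le_exp.2 ?_
  exact mul_le_mul (le_abs_self t) (regNorm_le hε x) (Real.sqrt_nonneg _) (abs_nonneg _)

lemma integrable_exp_regNorm {ε : ℝ} (hε : 0 ≤ ε) (t : ℝ) :
    Integrable (fun x : κ → ℝ => Real.exp (t * regNorm ε x))
      (Measure.pi fun _ : κ => gaussianReal 0 1) :=
  (expBounded_exp_regNorm hε t).integrable
    ((continuous_regNorm ε).const_mul t |>.rexp).measurable

lemma integral_sq_mul_exp_regNorm {ε : ℝ} (hε : 0 < ε) (t : ℝ) (k : κ) :
    Integrable (fun x : κ → ℝ => x k ^ 2 * Real.exp (t * regNorm ε x))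
      (Measure.pi fun _ : κ => gaussianReal 0 1) ∧
    Integrable (fun x : κ → ℝ => Real.exp (t * regNorm ε x) * (1 + t * (x k ^ 2 / regNorm ε x)))
      (Measure.pi fun _ : κ => gaussianReal 0 1) ∧
    ∫ x, x k ^ 2 * Real.exp (t * regNorm ε x) ∂(Measure.pi fun _ : κ => gaussianReal 0 1) =
      ∫ x, Real.exp (t * regNorm ε x) * (1 + t * (x k ^ 2 / regNorm ε x))
        ∂(Measure.pi fun _ : κ => gaussianReal 0 1) := by
  classical
  have hcont := continuous_regNorm (κ := κ) ε
  have hsum : ∀ x : κ → ℝ, ∑ j, (Pi.single k (1 : ℝ) : κ → ℝ) j * x j = x k := fun x => by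
    simp [Pi.single_apply]
  have hx : ExpBounded fun x : κ → ℝ => x k := by
    simpa only [hsum] using expBounded_linear (Pi.single k (1 : ℝ) : κ → ℝ)
  have hE := expBounded_exp_regNorm (κ := κ) hε.le t
  have hf := hx.mul hE
  have hq : ExpBounded fun x : κ → ℝ => x k ^ 2 / regNorm ε x :=
    (expBounded_regNorm hε.le).mono fun x => by
      have hp := regNorm_pos hε x
      rw [abs_of_pos hp, abs_of_nonneg (by positivity), div_le_iff₀ hp, ← sq, sq_regNorm hε.le]
      have := Finset.single_le_sum (f := fun k => x k ^ 2) (fun _ _ => sq_nonneg _)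
        (Finset.mem_univ k)
      linarith
  have hf' := hE.mul ((ExpBounded.const 1).add ((ExpBounded.const t).mul hq))
  have hfm : Measurable fun x : κ → ℝ => x k * Real.exp (t * regNorm ε x) := by
    fun_prop
  have hfm' : Measurable fun x : κ → ℝ =>
      Real.exp (t * regNorm ε x) * (1 + t * (x k ^ 2 / regNorm ε x)) := by
    have := hcont.measurable
    fun_prop
  have hsq : ∀ x : κ → ℝ, x k ^ 2 * Real.exp (t * regNorm ε x) =
      x k * (x k * Real.exp (t * regNorm ε x)) := fun x => by ring
  have ibp := gaussian_integral_by_parts (Pi.single k 1) hf hf' hfm hfm' fun x => by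
    have h0 : HasDerivAt (fun s : ℝ => ∑ j, (x + s • (Pi.single k 1 : κ → ℝ)) j ^ 2)
        (2 * x k) 0 := by
      refine (HasDerivAt.fun_sum (u := Finset.univ) (A' := fun j => 2 * x j * (Pi.single k 1 : κ → ℝ) j)
        fun j _ => ?_).congr_deriv (by simp [Pi.single_apply])
      have : HasDerivAt (fun s : ℝ => x j + s * (Pi.single k 1 : κ → ℝ) j)
          ((Pi.single k 1 : κ → ℝ) j) 0 := by
        simpa using ((hasDerivAt_id (0 : ℝ)).mul_const _).const_add (x j)
      refine (this.fun_pow 2).congr_deriv ?_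
      simp
    have hp := regNorm_pos hε x
    have h1 : HasDerivAt (fun s : ℝ => regNorm ε (x + s • (Pi.single k 1 : κ → ℝ)))
        (x k / regNorm ε x) 0 := by
      refine ((h0.const_add ε).sqrt ?_).congr_deriv ?_
      · simp only [zero_smul, add_zero]
        positivity
      · simp only [zero_smul, add_zero]
        rw [mul_div_mul_left _ _ two_ne_zero, regNorm]
    have h2 : HasDerivAt (fun s : ℝ => (x + s • (Pi.single k 1 : κ → ℝ)) k) 1 0 := by
      simpa using (hasDerivAt_id (0 : ℝ)).const_add (x k)
    refine (h2.mul (h1.const_mul t).exp).congr_deriv ?_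
    simp only [zero_smul, add_zero]
    field_simp
  simp only [hsum, ← hsq] at ibp
  refine ⟨?_, hf'.integrable hfm', ibp⟩
  simp only [hsq]
  exact (hx.mul hf).integrable (.mul (by fun_prop) hfm)

lemma mgf_regNorm_le {ε : ℝ} (hε : 0 < ε) {t : ℝ} (ht : 0 ≤ t) :
    mgf (regNorm ε) (Measure.pi fun _ : κ => gaussianReal 0 1) t ≤
      Real.exp (t * Real.sqrt (Fintype.card κ + ε) + t ^ 2 / 2) := by
  set γ := Measure.pi fun _ : κ => gaussianReal 0 1 with hγ
  set R := Real.sqrt (Fintype.card κ + ε) with hR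
  have hR2 : R ^ 2 = Fintype.card κ + ε := Real.sq_sqrt (by positivity)
  have hR0 : 0 ≤ R := Real.sqrt_nonneg _
  have hcont := continuous_regNorm (κ := κ) ε
  have hI : ∀ t, Integrable (fun x : κ → ℝ => Real.exp (t * regNorm ε x)) γ :=
    integrable_exp_regNorm hε.le
  have huniv : integrableExpSet (regNorm ε) γ = Set.univ := Set.eq_univ_of_forall hI
  have hd : ∀ t, HasDerivAt (mgf (regNorm ε) γ)
      (∫ x, regNorm ε x * Real.exp (t * regNorm ε x) ∂γ) t := fun t =>
    hasDerivAt_mgf (by rw [huniv, interior_univ]; trivial)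
  have hpos : ∀ t, 0 < mgf (regNorm ε) γ t := fun t => mgf_pos (hI t)
  have hineq : ∀ t, 0 ≤ t → ∫ x, regNorm ε x * Real.exp (t * regNorm ε x) ∂γ ≤
      (R + t) * mgf (regNorm ε) γ t := fun t ht => by
    set M := mgf (regNorm ε) γ t with hM
    set M' := ∫ x, regNorm ε x * Real.exp (t * regNorm ε x) ∂γ with hM'
    have hM0 : 0 < M := hpos t
    have i1 : Integrable (fun x => regNorm ε x * Real.exp (t * regNorm ε x)) γ :=
      ((expBounded_regNorm hε.le).mul (expBounded_exp_regNorm hε.le t)).integrable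
        (by fun_prop)
    have i2 : Integrable (fun x => regNorm ε x ^ 2 * Real.exp (t * regNorm ε x)) γ := by
      simpa only [sq, mul_assoc] using ((expBounded_regNorm hε.le).mul
        ((expBounded_regNorm hε.le).mul (expBounded_exp_regNorm hε.le t))).integrable
        (f := fun x => regNorm ε x * (regNorm ε x * Real.exp (t * regNorm ε x))) (by fun_prop)
    have hibp := fun k : κ => integral_sq_mul_exp_regNorm hε t k
    have e1 : ∫ x, regNorm ε x ^ 2 * Real.exp (t * regNorm ε x) ∂γ ≤
        (Fintype.card κ + ε) * M + t * M' := by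
      have s1 : ∫ x, regNorm ε x ^ 2 * Real.exp (t * regNorm ε x) ∂γ =
          ε * M + ∫ x, ∑ k, x k ^ 2 * Real.exp (t * regNorm ε x) ∂γ := by
        rw [hM, mgf, ← integral_const_mul, ← integral_add ((hI t).const_mul ε)
          (integrable_finsetSum _ fun k _ => (hibp k).1)]
        refine integral_congr_ae (ae_of_all _ fun x => ?_)
        simp only [sq_regNorm hε.le, add_mul, Finset.sum_mul]
      have s2 : ∫ x, ∑ k, x k ^ 2 * Real.exp (t * regNorm ε x) ∂γ =
          ∫ x, ∑ k, Real.exp (t * regNorm ε x) * (1 + t * (x k ^ 2 / regNorm ε x)) ∂γ := by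
        rw [integral_finsetSum _ fun k _ => (hibp k).1,
          integral_finsetSum _ fun k _ => (hibp k).2.1]
        exact Finset.sum_congr rfl fun k _ => (hibp k).2.2
      have s3 : ∫ x, ∑ k, Real.exp (t * regNorm ε x) * (1 + t * (x k ^ 2 / regNorm ε x)) ∂γ ≤
          ∫ x, (Fintype.card κ * Real.exp (t * regNorm ε x) +
            t * (regNorm ε x * Real.exp (t * regNorm ε x))) ∂γ := by
        refine integral_mono (integrable_finsetSum _ fun k _ => (hibp k).2.1)
          (((hI t).const_mul _).add (i1.const_mul _)) fun x => ?_
        have hp := regNorm_pos hε x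
        have hs : (∑ k, x k ^ 2) / regNorm ε x ≤ regNorm ε x := by
          rw [div_le_iff₀ hp, ← sq, sq_regNorm hε.le]
          linarith
        have : ∑ k, Real.exp (t * regNorm ε x) * (1 + t * (x k ^ 2 / regNorm ε x)) =
            Real.exp (t * regNorm ε x) * (Fintype.card κ + t * ((∑ k, x k ^ 2) / regNorm ε x)) := by
          rw [← Finset.mul_sum, Finset.sum_add_distrib, ← Finset.mul_sum, Finset.sum_div]
          simp
        simp only [this]
        nlinarith [mul_le_mul_of_nonneg_left (mul_le_mul_of_nonneg_left hs ht)
          (Real.exp_pos (t * regNorm ε x)).le]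
      rw [integral_add ((hI t).const_mul _) (i1.const_mul _), integral_const_mul,
        integral_const_mul] at s3
      have : ∫ x, Real.exp (t * regNorm ε x) ∂γ = M := rfl
      rw [this] at s3
      linarith
    by_contra! hlt
    set u := M' / M with hu
    have hMu : M' = u * M := by rw [hu, div_mul_cancel₀ _ hM0.ne']
    clear_value u
    have hlu : R + t < u := by rwa [hMu, mul_lt_mul_iff_left₀ hM0] at hlt
    have e2 : 0 ≤ ∫ x, (regNorm ε x - u) ^ 2 * Real.exp (t * regNorm ε x) ∂γ :=
      integral_nonneg fun x => by positivity
    have e3 : ∫ x, (regNorm ε x - u) ^ 2 * Real.exp (t * regNorm ε x) ∂γ =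
        (∫ x, regNorm ε x ^ 2 * Real.exp (t * regNorm ε x) ∂γ) - 2 * u * M' + u ^ 2 * M := by
      have j1 : Integrable (fun x => 2 * u * (regNorm ε x * Real.exp (t * regNorm ε x))) γ :=
        i1.const_mul _
      have j2 : Integrable (fun x => u ^ 2 * Real.exp (t * regNorm ε x)) γ := (hI t).const_mul _
      have j3 : Integrable (fun x => regNorm ε x ^ 2 * Real.exp (t * regNorm ε x) -
          2 * u * (regNorm ε x * Real.exp (t * regNorm ε x))) γ := i2.sub j1
      have hMt : M = ∫ x, Real.exp (t * regNorm ε x) ∂γ := rfl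
      rw [hMt, hM', ← integral_const_mul, ← integral_sub i2 j1, ← integral_const_mul,
        ← integral_add j3 j2]
      refine integral_congr_ae (ae_of_all _ fun x => ?_)
      ring
    rw [e3, hMu] at e2
    rw [hMu, ← hR2] at e1
    have : 0 ≤ (R ^ 2 + t * u - u ^ 2) * M := by linarith
    have : 0 ≤ R ^ 2 + t * u - u ^ 2 := nonneg_of_mul_nonneg_left this hM0
    nlinarith [mul_nonneg hR0 ht, mul_pos (sub_pos.2 hlu) (by linarith : 0 < u + R + t)]
  set ψ : ℝ → ℝ := fun s => mgf (regNorm ε) γ s * Real.exp (-(s * R + s ^ 2 / 2)) with hψ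
  have hψd : ∀ s, HasDerivAt ψ (Real.exp (-(s * R + s ^ 2 / 2)) *
      ((∫ x, regNorm ε x * Real.exp (s * regNorm ε x) ∂γ) - (R + s) * mgf (regNorm ε) γ s)) s :=
    fun s => by
      have : HasDerivAt (fun s : ℝ => -(s * R + s ^ 2 / 2)) (-(1 * R + 2 * s / 2)) s := by
        refine (((hasDerivAt_id s).mul_const R).fun_add
          ((hasDerivAt_pow 2 s).div_const 2)).fun_neg.congr_deriv ?_
        simp
      refine ((hd s).mul this.exp).congr_deriv ?_
      ring
  have hanti : AntitoneOn ψ (Set.Ici 0) := by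
    refine antitoneOn_of_deriv_nonpos (convex_Ici _)
      (fun s _ => (hψd s).continuousAt.continuousWithinAt)
      (fun s _ => (hψd s).differentiableAt.differentiableWithinAt) fun s hs => ?_
    rw [interior_Ici] at hs
    rw [(hψd s).deriv]
    exact mul_nonpos_of_nonneg_of_nonpos (Real.exp_pos _).le
      (sub_nonpos.2 (hineq s (le_of_lt hs)))
  have := hanti (Set.self_mem_Ici) (Set.mem_Ici.2 ht) ht
  simp only [hψ, mgf_zero, Real.exp_neg] at this
  simp only [zero_mul, ne_eq, OfNat.ofNat_ne_zero, not_false_eq_true, zero_pow, zero_div, add_zero,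
    Real.exp_zero, inv_one, mul_one] at this
  rwa [← div_eq_mul_inv, div_le_one (Real.exp_pos _)] at this

/-- The moment generating function of the norm of a standard Gaussian vector. -/
theorem integral_exp_norm_gaussian_le {t : ℝ} (ht : 0 ≤ t) :
    ∫ x, Real.exp (t * Real.sqrt (∑ k, x k ^ 2)) ∂(Measure.pi fun _ : κ => gaussianReal 0 1) ≤
      Real.exp (t * Real.sqrt (Fintype.card κ) + t ^ 2 / 2) := by
  have h : ∀ ε : ℝ, 0 < ε →
      ∫ x, Real.exp (t * Real.sqrt (∑ k, x k ^ 2)) ∂(Measure.pi fun _ : κ => gaussianReal 0 1) ≤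
        Real.exp (t * Real.sqrt (Fintype.card κ + ε) + t ^ 2 / 2) := fun ε hε => by
    refine le_trans ?_ (mgf_regNorm_le hε ht)
    refine integral_mono (by simpa [regNorm] using integrable_exp_regNorm (κ := κ) le_rfl t)
      (integrable_exp_regNorm hε.le t) fun x => Real.exp_le_exp.2 ?_
    exact mul_le_mul_of_nonneg_left (Real.sqrt_le_sqrt (by linarith)) ht
  have hlim : Filter.Tendsto
      (fun ε : ℝ => Real.exp (t * Real.sqrt (Fintype.card κ + ε) + t ^ 2 / 2))
      (nhdsWithin 0 (Set.Ioi 0)) (nhds (Real.exp (t * Real.sqrt (Fintype.card κ) + t ^ 2 / 2))) := by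
    have : Continuous fun ε : ℝ => Real.exp (t * Real.sqrt (Fintype.card κ + ε) + t ^ 2 / 2) := by
      fun_prop
    simpa using (this.tendsto 0).mono_left nhdsWithin_le_nhds
  exact ge_of_tendsto hlim (Filter.eventually_of_mem self_mem_nhdsWithin fun ε hε => h ε hε)

end NormMgf

section Chevet

variable {p q : Type*} [Fintype p] [Fintype q]

lemma sum_mul_le_one {u u' : p → ℝ} (hu : ∑ i, u i ^ 2 = 1) (hu' : ∑ i, u' i ^ 2 = 1) :
    ∑ i, u i * u' i ≤ 1 := by
  have h : 0 ≤ ∑ i, (u i - u' i) ^ 2 := by positivity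
  have h2 : ∑ i, (u i - u' i) ^ 2 = ∑ i, u i ^ 2 + ∑ i, u' i ^ 2 - 2 * ∑ i, u i * u' i := by
    rw [Finset.mul_sum, ← Finset.sum_add_distrib, ← Finset.sum_sub_distrib]
    exact Finset.sum_congr rfl fun _ _ => by ring
  linarith

lemma sum_mul_le_sqrt {v : p → ℝ} (hv : ∑ i, v i ^ 2 = 1) (g : p → ℝ) :
    ∑ i, v i * g i ≤ Real.sqrt (∑ i, g i ^ 2) := by
  refine Real.le_sqrt_of_sq_le ?_
  have := Finset.sum_mul_sq_le_sq_mul_sq Finset.univ v g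
  rwa [hv, one_mul] at this

lemma integrable_exp_norm (t : ℝ) :
    Integrable (fun x : p → ℝ => Real.exp (t * Real.sqrt (∑ k, x k ^ 2)))
      (Measure.pi fun _ : p => gaussianReal 0 1) := by
  simpa [regNorm] using integrable_exp_regNorm (κ := p) le_rfl t

lemma measurePreserving_comp_inl :
    MeasurePreserving (fun (x : p ⊕ q → ℝ) i => x (.inl i))
      (Measure.pi fun _ => gaussianReal 0 1) (Measure.pi fun _ => gaussianReal 0 1) :=
  measurePreserving_fst.comp
    (measurePreserving_sumPiEquivProdPi (X := fun _ : p ⊕ q => ℝ) fun _ => gaussianReal 0 1)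

lemma measurePreserving_comp_inr :
    MeasurePreserving (fun (x : p ⊕ q → ℝ) i => x (.inr i))
      (Measure.pi fun _ => gaussianReal 0 1) (Measure.pi fun _ => gaussianReal 0 1) :=
  measurePreserving_snd.comp
    (measurePreserving_sumPiEquivProdPi (X := fun _ : p ⊕ q => ℝ) fun _ => gaussianReal 0 1)

lemma integral_exp_add_norm_gaussian_le {t : ℝ} (ht : 0 ≤ t) :
    Integrable (fun x : q ⊕ p → ℝ => Real.exp (t * Real.sqrt (∑ j, x (.inl j) ^ 2)) *
      Real.exp (t * Real.sqrt (∑ i, x (.inr i) ^ 2))) (Measure.pi fun _ => gaussianReal 0 1) ∧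
    ∫ x : q ⊕ p → ℝ, Real.exp (t * Real.sqrt (∑ j, x (.inl j) ^ 2)) *
        Real.exp (t * Real.sqrt (∑ i, x (.inr i) ^ 2)) ∂(Measure.pi fun _ => gaussianReal 0 1) ≤
      Real.exp (t * (Real.sqrt (Fintype.card p) + Real.sqrt (Fintype.card q)) + t ^ 2) := by
  have hmp := measurePreserving_sumPiEquivProdPi (X := fun _ : q ⊕ p => ℝ) fun _ => gaussianReal 0 1
  have hint := (integrable_exp_norm (p := q) t).mul_prod (integrable_exp_norm (p := p) t)
  refine ⟨hmp.integrable_comp_of_integrable hint, ?_⟩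
  have := hmp.integral_comp' fun z : (q → ℝ) × (p → ℝ) =>
    Real.exp (t * Real.sqrt (∑ k, z.1 k ^ 2)) * Real.exp (t * Real.sqrt (∑ k, z.2 k ^ 2))
  refine (this.trans (integral_prod_mul
    (fun x : q → ℝ => Real.exp (t * Real.sqrt (∑ k, x k ^ 2)))
    (fun x : p → ℝ => Real.exp (t * Real.sqrt (∑ k, x k ^ 2))))).le.trans ?_
  refine (mul_le_mul (integral_exp_norm_gaussian_le ht) (integral_exp_norm_gaussian_le ht)
    (integral_nonneg fun _ => (Real.exp_pos _).le) (Real.exp_pos _).le).trans_eq ?_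
  rw [← Real.exp_add]
  ring_nf

/-- Chevet's inequality for a soft maximum of the bilinear Gaussian process. -/
theorem integral_softPow_bilinear_le {ι : Type*} [Fintype ι] [Nonempty ι] {α t : ℝ} (hα : 0 < α)
    (hα1 : α ≤ 1) (ht : 0 ≤ t) (u : ι → p → ℝ) (v : ι → q → ℝ)
    (hu : ∀ i, ∑ j, u i j ^ 2 = 1) (hv : ∀ i, ∑ j, v i j ^ 2 = 1) :
    ∫ x, softPow α (t / α) (fun i => ∑ k : p × q, u i k.1 * v i k.2 * x k)
        ∂(Measure.pi fun _ : p × q => gaussianReal 0 1) ≤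
      (Fintype.card ι : ℝ) ^ α *
        Real.exp (t * (Real.sqrt (Fintype.card p) + Real.sqrt (Fintype.card q)) + t ^ 2 / 2) := by
  have hβ : 0 ≤ t / α := by positivity
  have hαβ : α * (t / α) = t := mul_div_cancel₀ _ hα.ne'
  set a : ι → (p × q) ⊕ (q ⊕ p) → ℝ := fun i =>
    Sum.elim (fun k => u i k.1 * v i k.2) fun _ => 0 with ha
  set b : ι → (p × q) ⊕ (q ⊕ p) → ℝ := fun i => Sum.elim (fun _ => 0) (Sum.elim (v i) (u i)) with hb
  have haa : ∀ i j, ∑ k, a i k * a j k = (∑ k, u i k * u j k) * ∑ k, v i k * v j k := by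
    intro i j
    simp only [ha, Fintype.sum_sum_type, Sum.elim_inl, Sum.elim_inr, mul_zero,
      Finset.sum_const_zero, add_zero, Fintype.sum_prod_type, Finset.sum_mul_sum]
    exact Finset.sum_congr rfl fun _ _ => Finset.sum_congr rfl fun _ _ => by ring
  have hbb : ∀ i j, ∑ k, b i k * b j k = ∑ k, v i k * v j k + ∑ k, u i k * u j k := by
    intro i j
    simp [hb]
  have hcmp := softPow_gaussian_comparison hα.le hα1 hβ a b (fun i j => by simp [ha, hb])
    (fun i j => by
      rw [haa, hbb]
      nlinarith [mul_nonneg (sub_nonneg.2 (sum_mul_le_one (hu i) (hu j)))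
        (sub_nonneg.2 (sum_mul_le_one (hv i) (hv j)))])
    (fun i => by
      rw [haa, hbb]
      simp only [← sq, hu, hv]
      norm_num)
  rw [hαβ] at hcmp
  have hA : ∫ x, softPow α (t / α) (fun i => ∑ k, a i k * x k)
        ∂(Measure.pi fun _ : (p × q) ⊕ (q ⊕ p) => gaussianReal 0 1) =
      ∫ x, softPow α (t / α) (fun i => ∑ k : p × q, u i k.1 * v i k.2 * x k)
        ∂(Measure.pi fun _ : p × q => gaussianReal 0 1) := by
    have hmp := measurePreserving_comp_inl (p := p × q) (q := q ⊕ p)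
    have hc : Continuous fun x : p × q → ℝ => softPow α (t / α)
        (fun i => ∑ k : p × q, u i k.1 * v i k.2 * x k) :=
      (continuous_softPow α (t / α)).comp (by fun_prop)
    rw [← hmp.map_eq, integral_map hmp.measurable.aemeasurable hc.aestronglyMeasurable]
    simp [ha]
  have hB : ∫ x, softPow α (t / α) (fun i => ∑ k, b i k * x k)
        ∂(Measure.pi fun _ : (p × q) ⊕ (q ⊕ p) => gaussianReal 0 1) ≤
      (Fintype.card ι : ℝ) ^ α *
        Real.exp (t * (Real.sqrt (Fintype.card p) + Real.sqrt (Fintype.card q)) + t ^ 2) := by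
    have hmp := measurePreserving_comp_inr (p := p × q) (q := q ⊕ p)
    obtain ⟨hint, hle⟩ := integral_exp_add_norm_gaussian_le (p := p) (q := q) ht
    refine le_trans ?_ (mul_le_mul_of_nonneg_left hle (by positivity))
    rw [← hmp.map_eq] at hint ⊢
    rw [← integral_const_mul, integral_map hmp.measurable.aemeasurable
      (hint.const_mul _).aestronglyMeasurable]
    refine integral_mono_of_nonneg (ae_of_all _ fun x => (softPow_pos _ _ _).le)
      ((hint.comp_measurable hmp.measurable).const_mul _) (ae_of_all _ fun x => ?_)
    refine (softPow_le_of_le hα.le hβ (B := Real.sqrt (∑ j, x (.inr (.inl j)) ^ 2) +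
      Real.sqrt (∑ i, x (.inr (.inr i)) ^ 2)) fun i => ?_).trans_eq ?_
    · simp only [hb, Fintype.sum_sum_type, Sum.elim_inl, Sum.elim_inr, zero_mul,
        Finset.sum_const_zero, zero_add]
      exact add_le_add (sum_mul_le_sqrt (hv i) _) (sum_mul_le_sqrt (hu i) _)
    · simp only [hαβ, mul_add, Real.exp_add]
  rw [hA] at hcmp
  have := hcmp.trans hB
  rw [← le_div_iff₀' (Real.exp_pos _), mul_div_assoc, ← Real.exp_sub] at this
  refine this.trans_eq ?_
  ring_nf

/-- Chevet's inequality, in exponential form, for a finite family of pairs of unit vectors. -/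
lemma lintegral_iSup_exp_bilinear_le_of_finite {ι : Type*} [Fintype ι] [Nonempty ι] {t : ℝ}
    (ht : 0 ≤ t) (u : ι → p → ℝ) (v : ι → q → ℝ)
    (hu : ∀ i, ∑ j, u i j ^ 2 = 1) (hv : ∀ i, ∑ j, v i j ^ 2 = 1) :
    ∫⁻ x, ⨆ i, ENNReal.ofReal (Real.exp (t * ∑ k : p × q, u i k.1 * v i k.2 * x k))
        ∂(Measure.pi fun _ : p × q => gaussianReal 0 1) ≤
      ENNReal.ofReal (Real.exp
        (t * (Real.sqrt (Fintype.card p) + Real.sqrt (Fintype.card q)) + t ^ 2 / 2)) := by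
  set C := Real.exp (t * (Real.sqrt (Fintype.card p) + Real.sqrt (Fintype.card q)) + t ^ 2 / 2)
  have h : ∀ α : ℝ, 0 < α → α ≤ 1 →
      ∫⁻ x, ⨆ i, ENNReal.ofReal (Real.exp (t * ∑ k : p × q, u i k.1 * v i k.2 * x k))
        ∂(Measure.pi fun _ : p × q => gaussianReal 0 1) ≤
      ENNReal.ofReal ((Fintype.card ι : ℝ) ^ α * C) := fun α hα hα1 => by
    have hβ : 0 ≤ t / α := by positivity
    refine le_trans ?_ (ENNReal.ofReal_le_ofReal
      (integral_softPow_bilinear_le hα hα1 ht u v hu hv))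
    have hc := (continuous_softPow (ι := ι) α (t / α)).comp
      (f := fun (x : p × q → ℝ) i => ∑ k : p × q, u i k.1 * v i k.2 * x k) (by fun_prop)
    rw [ofReal_integral_eq_lintegral_ofReal
      ((expBounded_softPow_linear hα.le hβ fun i (k : p × q) => u i k.1 * v i k.2).integrable
        hc.measurable) (ae_of_all _ fun x => (softPow_pos _ _ _).le)]
    refine lintegral_mono fun x => iSup_le fun i => ENNReal.ofReal_le_ofReal ?_
    have := exp_le_softPow (β := t / α) hα.le (fun i => ∑ k : p × q, u i k.1 * v i k.2 * x k) i
    rwa [mul_div_cancel₀ _ hα.ne'] at this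
  have hlim : Filter.Tendsto (fun α : ℝ => ENNReal.ofReal ((Fintype.card ι : ℝ) ^ α * C))
      (nhdsWithin 0 (Set.Ioi 0)) (nhds (ENNReal.ofReal C)) := by
    refine ENNReal.tendsto_ofReal ?_
    have hN : (Fintype.card ι : ℝ) ≠ 0 := by positivity
    have := ((Real.continuous_const_rpow hN).mul_const C).tendsto 0
    simp only [Real.rpow_zero, one_mul] at this
    exact this.mono_left nhdsWithin_le_nhds
  refine ge_of_tendsto hlim (Filter.eventually_of_mem
    (Ioc_mem_nhdsGT (zero_lt_one' ℝ)) fun α hα => h α hα.1 hα.2)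

/-- Chevet's inequality, in exponential form, for a sequence of pairs of unit vectors. -/
theorem lintegral_iSup_exp_bilinear_le {t : ℝ} (ht : 0 ≤ t) (u : ℕ → p → ℝ) (v : ℕ → q → ℝ)
    (hu : ∀ i, ∑ j, u i j ^ 2 = 1) (hv : ∀ i, ∑ j, v i j ^ 2 = 1) :
    ∫⁻ x, ⨆ i, ENNReal.ofReal (Real.exp (t * ∑ k : p × q, u i k.1 * v i k.2 * x k))
        ∂(Measure.pi fun _ : p × q => gaussianReal 0 1) ≤
      ENNReal.ofReal (Real.exp
        (t * (Real.sqrt (Fintype.card p) + Real.sqrt (Fintype.card q)) + t ^ 2 / 2)) := by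
  set f : ℕ → (p × q → ℝ) → ENNReal := fun i x =>
    ENNReal.ofReal (Real.exp (t * ∑ k : p × q, u i k.1 * v i k.2 * x k)) with hf
  have hfm : ∀ i, Measurable (f i) := fun i => by fun_prop
  have hsup : ∀ x, ⨆ i, f i x = ⨆ N : ℕ, ⨆ i : Fin (N + 1), f i x := fun x =>
    le_antisymm
      (iSup_le fun i => le_iSup_of_le i (le_iSup (fun j : Fin (i + 1) => f j x) (Fin.last i)))
      (iSup_le fun N => iSup_le fun i => le_iSup (fun i => f i x) i)
  have hmono : Monotone fun (N : ℕ) x => ⨆ i : Fin (N + 1), f i x := fun N M hNM x =>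
    iSup_le fun i : Fin (N + 1) =>
      le_iSup (fun j : Fin (M + 1) => f j x) ⟨i, i.2.trans_le (Nat.succ_le_succ hNM)⟩
  have hmeas : ∀ N : ℕ, Measurable fun x => ⨆ i : Fin (N + 1), f i x := fun N =>
    .iSup fun i : Fin (N + 1) => hfm i
  rw [lintegral_congr hsup, lintegral_iSup hmeas hmono]
  exact iSup_le fun N => lintegral_iSup_exp_bilinear_le_of_finite ht
    (fun i : Fin (N + 1) => u i) (fun i => v i) (fun i => hu i) fun i => hv i

end Chevet

section Polar

variable {E : Type*} [NormedAddCommGroup E] [NormedSpace ℝ E] [FiniteDimensional ℝ E]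
  [MeasurableSpace E] [BorelSpace E] [Nontrivial E] (μ : Measure E) [μ.IsAddHaarMeasure]

lemma lintegral_norm_mul_direction {f : ℝ → ℝ≥0∞} {h : E → ℝ≥0∞} (hf : Measurable f)
    (hh : Measurable h) :
    ∫⁻ x, f ‖x‖ * h (‖x‖⁻¹ • x) ∂μ = (∫⁻ s, h s ∂μ.toSphere) *
      ∫⁻ r, f r ∂(Measure.volumeIoiPow (Module.finrank ℝ E - 1)) := by
  have hmp := μ.measurePreserving_homeomorphUnitSphereProd
  have hs : MeasurableSet ({0}ᶜ : Set E) := (measurableSet_singleton 0).compl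
  calc ∫⁻ x, f ‖x‖ * h (‖x‖⁻¹ • x) ∂μ
      = ∫⁻ x : ({0}ᶜ : Set E), f ‖x.1‖ * h (‖x.1‖⁻¹ • x.1) ∂(μ.comap (↑)) := by
        rw [lintegral_subtype_comap hs fun x => f ‖x‖ * h (‖x‖⁻¹ • x), restrict_compl_singleton]
    _ = ∫⁻ z, h z.1 * f z.2
          ∂(μ.toSphere.prod (Measure.volumeIoiPow (Module.finrank ℝ E - 1))) := by
        rw [← hmp.lintegral_comp_emb (Homeomorph.measurableEmbedding _)]
        refine lintegral_congr fun x => ?_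
        simp [mul_comm]
    _ = _ := lintegral_prod_mul (hh.comp measurable_subtype_coe).aemeasurable
        (hf.comp measurable_subtype_coe).aemeasurable

lemma indepFun_norm_direction {w : ℝ → ℝ≥0∞} (hw : Measurable w)
    [hP : IsProbabilityMeasure (μ.withDensity fun x => w ‖x‖)] :
    IndepFun (fun x : E => ‖x‖) (fun x : E => ‖x‖⁻¹ • x) (μ.withDensity fun x => w ‖x‖) := by
  have hwm : Measurable fun x : E => w ‖x‖ := by fun_prop
  have hdir : Measurable fun x : E => ‖x‖⁻¹ • x := by fun_prop
  have key : ∀ (A : Set ℝ) (B : Set E), MeasurableSet A → MeasurableSet B →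
      (μ.withDensity fun x => w ‖x‖) ((fun x : E => ‖x‖) ⁻¹' A ∩ (fun x : E => ‖x‖⁻¹ • x) ⁻¹' B) =
        (∫⁻ s, B.indicator 1 s.1 ∂μ.toSphere) *
          ∫⁻ r, A.indicator w r.1 ∂(Measure.volumeIoiPow (Module.finrank ℝ E - 1)) := by
    intro A B hA hB
    have hAB := (measurable_norm hA).inter (hdir hB)
    rw [withDensity_apply _ hAB, ← lintegral_indicator hAB,
      ← lintegral_norm_mul_direction μ (hw.indicator hA) (measurable_one.indicator hB)]
    refine lintegral_congr fun x => ?_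
    by_cases h1 : ‖x‖ ∈ A <;> by_cases h2 : ‖x‖⁻¹ • x ∈ B <;> simp [Set.indicator, h1, h2]
  rw [indepFun_iff_measure_inter_preimage_eq_mul]
  intro A B hA hB
  have k1 := key A B hA hB
  have k2 := key A Set.univ hA .univ
  have k3 := key Set.univ B .univ hB
  have k4 := key Set.univ Set.univ .univ .univ
  simp only [Set.preimage_univ, Set.inter_univ, Set.univ_inter, measure_univ] at k2 k3 k4
  rw [k1, k2, k3, ← mul_one ((∫⁻ s, _ ∂μ.toSphere) * ∫⁻ r, A.indicator w _ ∂_), k4]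
  ring

end Polar

section GammaRatio

lemma sub_half_mul_sq_Gamma_le {y : ℝ} (hy : 1 / 2 < y) :
    (y - 1 / 2) * Real.Gamma y ^ 2 ≤ Real.Gamma (y + 1 / 2) ^ 2 := by
  have h1 : 0 < y - 1 / 2 := by linarith
  have h2 : 0 < y + 1 / 2 := by linarith
  have hy0 : 0 < y := by linarith
  have hc := Real.convexOn_log_Gamma.2 (Set.mem_Ioi.2 h1) (Set.mem_Ioi.2 h2)
    (by norm_num : (0 : ℝ) ≤ 1 / 2) (by norm_num : (0 : ℝ) ≤ 1 / 2) (by norm_num)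
  have hg1 := Real.Gamma_pos_of_pos h1
  have hg2 := Real.Gamma_pos_of_pos h2
  have hg := Real.Gamma_pos_of_pos hy0
  have hmid : (1 / 2 : ℝ) • (y - 1 / 2) + (1 / 2 : ℝ) • (y + 1 / 2) = y := by
    simp only [smul_eq_mul]
    ring
  rw [hmid] at hc
  simp only [Function.comp_apply, smul_eq_mul] at hc
  have hlog : Real.log (Real.Gamma y ^ 2) ≤
      Real.log (Real.Gamma (y - 1 / 2) * Real.Gamma (y + 1 / 2)) := by
    rw [Real.log_pow, Real.log_mul hg1.ne' hg2.ne']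
    push_cast
    linarith
  have hle := (Real.log_le_log_iff (by positivity) (by positivity)).1 hlog
  have hrec : Real.Gamma (y + 1 / 2) = (y - 1 / 2) * Real.Gamma (y - 1 / 2) := by
    rw [← Real.Gamma_add_one h1.ne']
    ring_nf
  calc (y - 1 / 2) * Real.Gamma y ^ 2
      ≤ (y - 1 / 2) * (Real.Gamma (y - 1 / 2) * Real.Gamma (y + 1 / 2)) :=
        mul_le_mul_of_nonneg_left hle h1.le
    _ = ((y - 1 / 2) * Real.Gamma (y - 1 / 2)) * Real.Gamma (y + 1 / 2) := by ring
    _ = Real.Gamma (y + 1 / 2) ^ 2 := by rw [← hrec, sq]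

/-- A sharp form of Gautschi's inequality at exponent one half. -/
lemma sub_quarter_mul_sq_Gamma_le {x : ℝ} (hx : 1 / 4 < x) :
    (x - 1 / 4) * Real.Gamma x ^ 2 ≤ Real.Gamma (x + 1 / 2) ^ 2 := by
  set f : ℝ → ℝ := fun y => Real.Gamma (y + 1 / 2) ^ 2 / ((y - 1 / 4) * Real.Gamma y ^ 2) with hf
  have hpos : ∀ y : ℝ, 1 / 4 < y → 0 < (y - 1 / 4) * Real.Gamma y ^ 2 := fun y hy =>
    mul_pos (by linarith) (pow_pos (Real.Gamma_pos_of_pos (by linarith)) 2)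
  have hstep : ∀ y : ℝ, 1 / 4 < y → f (y + 1) ≤ f y := fun y hy => by
    have hy0 : 0 < y := by linarith
    have hg := Real.Gamma_pos_of_pos hy0
    have hg' : 0 < Real.Gamma (y + 1 / 2) := Real.Gamma_pos_of_pos (by linarith)
    have e1 : Real.Gamma (y + 1 + 1 / 2) = (y + 1 / 2) * Real.Gamma (y + 1 / 2) := by
      rw [← Real.Gamma_add_one (by linarith)]
      ring_nf
    have hq : 0 < y - 1 / 4 := by linarith
    have hq' : 0 < y + 1 - 1 / 4 := by linarith
    simp only [hf, e1, Real.Gamma_add_one hy0.ne']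
    rw [div_le_div_iff₀ (by positivity) (by positivity)]
    have : (y + 1 / 2) ^ 2 * (y - 1 / 4) ≤ (y + 1 - 1 / 4) * y ^ 2 := by nlinarith
    have := mul_le_mul_of_nonneg_right this
      (by positivity : 0 ≤ Real.Gamma (y + 1 / 2) ^ 2 * Real.Gamma y ^ 2)
    linarith
  have hiter : ∀ k : ℕ, f (x + k) ≤ f x := fun k => by
    induction k with
    | zero => simp
    | succ k ih =>
      refine le_trans ?_ ih
      have := hstep (x + k) (by have : (0 : ℝ) ≤ k := k.cast_nonneg; linarith)
      push_cast
      rwa [← add_assoc]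
  have hlow : ∀ k : ℕ, 1 - 1 / 4 / (x - 1 / 4 + (k + 1 : ℕ)) ≤ f x := fun k => by
    have hk : (0 : ℝ) ≤ k := k.cast_nonneg
    refine le_trans ?_ (hiter (k + 1))
    have hp := hpos (x + (k + 1 : ℕ)) (by push_cast; linarith)
    simp only [hf]
    rw [le_div_iff₀ hp]
    refine le_trans (le_of_eq ?_) (sub_half_mul_sq_Gamma_le (by push_cast; linarith))
    have : x - 1 / 4 + ((k + 1 : ℕ) : ℝ) ≠ 0 := by push_cast; linarith
    rw [← mul_assoc]
    congr 1
    have e : x + ((k + 1 : ℕ) : ℝ) - 1 / 4 = x - 1 / 4 + ((k + 1 : ℕ) : ℝ) := by ring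
    rw [e, sub_mul, one_mul, div_mul_cancel₀ _ this]
    ring
  have hlim : Filter.Tendsto (fun k : ℕ => 1 - 1 / 4 / (x - 1 / 4 + (k + 1 : ℕ))) Filter.atTop
      (nhds (1 - 0)) := by
    refine tendsto_const_nhds.sub (Filter.Tendsto.const_div_atTop ?_ _)
    exact Filter.tendsto_atTop_add_const_left _ _
      (tendsto_natCast_atTop_atTop.comp (Filter.tendsto_add_atTop_nat 1))
  have h1 : 1 ≤ f x := by simpa using le_of_tendsto' hlim hlow
  rwa [hf, le_div_iff₀ (hpos x hx), one_mul] at h1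

end GammaRatio

section RadialLaw

/-- The density of the standard Gaussian measure as a function of the norm. -/
noncomputable def radialDensity (m : ℕ) (r : ℝ) : ℝ :=
  (Real.sqrt (2 * Real.pi))⁻¹ ^ m * Real.exp (-r ^ 2 / 2)

lemma radialDensity_nonneg (m : ℕ) (r : ℝ) : 0 ≤ radialDensity m r := by
  unfold radialDensity
  positivity

lemma euclNorm_nonneg {m : ℕ} (x : Fin m → ℝ) : 0 ≤ euclNorm x := Real.sqrt_nonneg _

lemma sq_euclNorm {m : ℕ} (x : Fin m → ℝ) : euclNorm x ^ 2 = ∑ i, x i ^ 2 :=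
  Real.sq_sqrt (by positivity)

lemma continuous_euclNorm {m : ℕ} : Continuous (euclNorm : (Fin m → ℝ) → ℝ) := by
  unfold euclNorm
  fun_prop

lemma measurable_direction {m : ℕ} :
    Measurable fun x : Fin m → ℝ => (euclNorm x)⁻¹ • x := by
  have := (continuous_euclNorm (m := m)).measurable
  fun_prop

lemma euclNorm_ofLp {m : ℕ} (x : EuclideanSpace ℝ (Fin m)) :
    euclNorm (WithLp.ofLp x) = ‖x‖ := by
  simp [euclNorm, EuclideanSpace.norm_eq]

instance (m : ℕ) : IsProbabilityMeasure (_root_.stdGaussian m) := by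
  unfold _root_.stdGaussian
  infer_instance

instance (m : ℕ) : IsProbabilityMeasure (uniformSphere m) :=
  Measure.isProbabilityMeasure_map measurable_direction.aemeasurable

/-- The law of the Euclidean norm of a standard Gaussian vector. -/
noncomputable def chiLaw (m : ℕ) : Measure ℝ := Measure.map euclNorm (_root_.stdGaussian m)

instance (m : ℕ) : IsProbabilityMeasure (chiLaw m) :=
  Measure.isProbabilityMeasure_map continuous_euclNorm.measurable.aemeasurable

lemma measurePreserving_ofLp_gaussian (m : ℕ) :
    MeasurePreserving (WithLp.ofLp : EuclideanSpace ℝ (Fin m) → Fin m → ℝ)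
      (volume.withDensity fun x => ENNReal.ofReal (radialDensity m ‖x‖))
      (_root_.stdGaussian m) := by
  have hmp := PiLp.volume_preserving_ofLp (Fin m)
  refine ⟨hmp.measurable, ?_⟩
  rw [_root_.stdGaussian, pi_gaussianReal_eq_withDensity]
  ext s hs
  have hd : Measurable fun x : Fin m → ℝ => ENNReal.ofReal
      ((Real.sqrt (2 * Real.pi))⁻¹ ^ Fintype.card (Fin m) * gaussWeight x) := by
    unfold gaussWeight
    fun_prop
  rw [Measure.map_apply hmp.measurable hs, withDensity_apply _ (hmp.measurable hs),
    withDensity_apply _ hs, ← hmp.setLIntegral_comp_preimage hs hd]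
  refine lintegral_congr fun x => ?_
  rw [radialDensity, gaussWeight, ← euclNorm_ofLp, sq_euclNorm, Fintype.card_fin]

variable {m : ℕ}

lemma isProbabilityMeasure_radial (m : ℕ) : IsProbabilityMeasure
    ((volume : Measure (EuclideanSpace ℝ (Fin m))).withDensity
      fun x => ENNReal.ofReal (radialDensity m ‖x‖)) := by
  constructor
  have h := (measurePreserving_ofLp_gaussian m).measure_preimage MeasurableSet.univ.nullMeasurableSet
  simpa using h

/-- A standard Gaussian vector is the product of its norm and an independent uniformly
distributed direction. -/
theorem measurePreserving_smul_chi_uniformSphere (hm : 1 ≤ m) :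
    MeasurePreserving (fun z : ℝ × (Fin m → ℝ) => z.1 • z.2)
      ((chiLaw m).prod (uniformSphere m)) (_root_.stdGaussian m) := by
  have : Nonempty (Fin m) := ⟨⟨0, hm⟩⟩
  have := isProbabilityMeasure_radial m
  have hofLp := measurePreserving_ofLp_gaussian m
  have hind := indepFun_norm_direction (volume : Measure (EuclideanSpace ℝ (Fin m)))
    (w := fun r => ENNReal.ofReal (radialDensity m r)) (by unfold radialDensity; fun_prop)
  have hind' := (hind.comp measurable_id hofLp.measurable)
  have hnm : Measurable fun x : EuclideanSpace ℝ (Fin m) => ‖x‖ := measurable_norm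
  have hdm : Measurable fun x : EuclideanSpace ℝ (Fin m) => WithLp.ofLp (‖x‖⁻¹ • x) :=
    hofLp.measurable.comp (by fun_prop)
  have e1 : Measure.map (fun x : EuclideanSpace ℝ (Fin m) => ‖x‖)
      (volume.withDensity fun x => ENNReal.ofReal (radialDensity m ‖x‖)) = chiLaw m := by
    rw [chiLaw, ← hofLp.map_eq, Measure.map_map continuous_euclNorm.measurable hofLp.measurable]
    exact Measure.map_congr (ae_of_all _ fun x => (euclNorm_ofLp x).symm)
  have e2 : Measure.map (fun x : EuclideanSpace ℝ (Fin m) => WithLp.ofLp (‖x‖⁻¹ • x))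
      (volume.withDensity fun x => ENNReal.ofReal (radialDensity m ‖x‖)) = uniformSphere m := by
    rw [uniformSphere, ← hofLp.map_eq, Measure.map_map measurable_direction hofLp.measurable]
    refine Measure.map_congr (ae_of_all _ fun x => ?_)
    simp [euclNorm_ofLp]
  have hsm : Measurable fun z : ℝ × (Fin m → ℝ) => z.1 • z.2 := by fun_prop
  refine ⟨hsm, ?_⟩
  have hind'' : Measure.map (fun x : EuclideanSpace ℝ (Fin m) => (‖x‖, WithLp.ofLp (‖x‖⁻¹ • x)))
      (volume.withDensity fun x => ENNReal.ofReal (radialDensity m ‖x‖)) =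
      (chiLaw m).prod (uniformSphere m) := by
    rw [← e1, ← e2]
    exact (indepFun_iff_map_prod_eq_prod_map_map hnm.aemeasurable hdm.aemeasurable).1 hind'
  rw [← hind'', Measure.map_map hsm (hnm.prodMk hdm), ← hofLp.map_eq]
  refine Measure.map_congr (ae_of_all _ fun x => ?_)
  rcases eq_or_ne x 0 with rfl | hx
  · simp
  · simp [smul_smul, norm_ne_zero_iff.2 hx]

lemma integral_rpow_mul_exp_neg_half_sq {q : ℝ} (hq : -1 < q) :
    ∫ y in Set.Ioi (0 : ℝ), y ^ q * Real.exp (-y ^ 2 / 2) =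
      (1 / 2) ^ (-(q + 1) / 2) * (1 / 2) * Real.Gamma ((q + 1) / 2) := by
  rw [← integral_rpow_mul_exp_neg_mul_rpow two_pos hq one_half_pos]
  refine integral_congr_ae (ae_of_all _ fun y => ?_)
  simp only [Real.rpow_two]
  ring_nf

lemma integral_chiLaw_eq (hm : 1 ≤ m) :
    ∫ r, r ∂(chiLaw m) =
      Real.sqrt 2 * Real.Gamma (m / 2 + 1 / 2) / Real.Gamma (m / 2) := by
  have : Nonempty (Fin m) := ⟨⟨0, hm⟩⟩
  have := isProbabilityMeasure_radial m
  have hofLp := measurePreserving_ofLp_gaussian m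
  have hden : Measurable fun x : EuclideanSpace ℝ (Fin m) => radialDensity m ‖x‖ := by
    unfold radialDensity
    fun_prop
  have key : ∀ f : ℝ → ℝ, ∫ x, f ‖x‖ ∂((volume : Measure (EuclideanSpace ℝ (Fin m))).withDensity
      fun x => ENNReal.ofReal (radialDensity m ‖x‖)) =
      (m * (volume : Measure (EuclideanSpace ℝ (Fin m))).real (Metric.ball 0 1) *
        (Real.sqrt (2 * Real.pi))⁻¹ ^ m) *
        ∫ y in Set.Ioi (0 : ℝ), y ^ (m - 1) * (Real.exp (-y ^ 2 / 2) * f y) := fun f => by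
    rw [integral_withDensity_eq_integral_toReal_smul hden.ennreal_ofReal
      (ae_of_all _ fun _ => ENNReal.ofReal_lt_top)]
    simp only [ENNReal.toReal_ofReal (radialDensity_nonneg _ _), smul_eq_mul]
    rw [integral_fun_norm_addHaar volume fun r => radialDensity m r * f r]
    simp only [finrank_euclideanSpace, Fintype.card_fin, nsmul_eq_mul, smul_eq_mul]
    rw [mul_assoc, mul_assoc, ← integral_const_mul ((Real.sqrt (2 * Real.pi))⁻¹ ^ m)]
    congr 3
    funext y
    rw [radialDensity]
    ring
  have hmean : ∫ r, r ∂(chiLaw m) = ∫ x, ‖x‖ ∂((volume : Measure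
      (EuclideanSpace ℝ (Fin m))).withDensity fun x => ENNReal.ofReal (radialDensity m ‖x‖)) := by
    rw [chiLaw, integral_map continuous_euclNorm.measurable.aemeasurable
      (f := fun r => r) aestronglyMeasurable_id, ← hofLp.map_eq, integral_map hofLp.measurable.aemeasurable
      continuous_euclNorm.aestronglyMeasurable]
    simp only [euclNorm_ofLp]
  have h1 := key fun _ => 1
  have h2 := key id
  simp only [integral_const, probReal_univ, smul_eq_mul, mul_one] at h1
  simp only [id] at h2
  have m0 : (0 : ℝ) < m := by exact_mod_cast hm
  have m1 : (1 : ℝ) ≤ m := by exact_mod_cast hm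
  have j1 : ∫ y in Set.Ioi (0 : ℝ), y ^ (m - 1) * Real.exp (-y ^ 2 / 2) =
      (1 / 2) ^ (-(m : ℝ) / 2) * (1 / 2) * Real.Gamma (m / 2) := by
    have := integral_rpow_mul_exp_neg_half_sq (q := ((m - 1 : ℕ) : ℝ)) (by
      have : (0 : ℝ) ≤ ((m - 1 : ℕ) : ℝ) := Nat.cast_nonneg _
      linarith)
    simp only [Real.rpow_natCast] at this
    simpa only [Nat.cast_sub hm, Nat.cast_one, sub_add_cancel] using this
  have j2 : ∫ y in Set.Ioi (0 : ℝ), y ^ (m - 1) * (Real.exp (-y ^ 2 / 2) * y) =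
      (1 / 2) ^ (-((m : ℝ) + 1) / 2) * (1 / 2) * Real.Gamma (m / 2 + 1 / 2) := by
    have := integral_rpow_mul_exp_neg_half_sq (q := (m : ℝ)) (by linarith)
    rw [add_div] at this
    rw [← this]
    refine integral_congr_ae (ae_of_all _ fun y => ?_)
    simp only [Real.rpow_natCast]
    obtain ⟨k, rfl⟩ : ∃ k, m = k + 1 := ⟨m - 1, by omega⟩
    simp only [Nat.add_sub_cancel, pow_succ]
    ring
  rw [j1] at h1
  rw [hmean, h2, j2]
  have hg : 0 < Real.Gamma ((m : ℝ) / 2) := Real.Gamma_pos_of_pos (by positivity)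
  rw [eq_div_iff hg.ne']
  have hs : (1 / 2 : ℝ) ^ (-((m : ℝ) + 1) / 2) = Real.sqrt 2 * (1 / 2 : ℝ) ^ (-(m : ℝ) / 2) := by
    rw [show -((m : ℝ) + 1) / 2 = -(1 / 2) + -(m : ℝ) / 2 by ring,
      Real.rpow_add (by norm_num), Real.rpow_neg (by norm_num), Real.sqrt_eq_rpow,
      ← Real.inv_rpow (by norm_num)]
    norm_num
  rw [hs]
  linear_combination (-(Real.sqrt 2 * Real.Gamma ((m : ℝ) / 2 + 1 / 2))) * h1

/-- The mean of the norm of a standard Gaussian vector is at least `√(m - 1/2)`. -/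
theorem sqrt_le_integral_chiLaw (hm : 1 ≤ m) :
    Real.sqrt ((m : ℝ) - 0.5) ≤ ∫ r, r ∂(chiLaw m) := by
  have m1 : (1 : ℝ) ≤ m := by exact_mod_cast hm
  have hg : 0 < Real.Gamma ((m : ℝ) / 2) := Real.Gamma_pos_of_pos (by positivity)
  have hg' : 0 < Real.Gamma ((m : ℝ) / 2 + 1 / 2) := Real.Gamma_pos_of_pos (by positivity)
  rw [integral_chiLaw_eq hm]
  refine Real.sqrt_le_iff.2 ⟨by positivity, ?_⟩
  rw [div_pow, mul_pow, Real.sq_sqrt zero_le_two, le_div_iff₀ (by positivity)]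
  have := sub_quarter_mul_sq_Gamma_le (x := (m : ℝ) / 2) (by linarith)
  norm_num at this ⊢
  linarith

end RadialLaw

section SphericalColumns

variable {m n : ℕ}

/-- The exponential of a scaled supremum of a sequence of bilinear forms. -/
noncomputable def expSup (u : ℕ → Fin n → ℝ) (v : ℕ → Fin m → ℝ) (t : ℝ)
    (S : Fin n → Fin m → ℝ) : ℝ≥0∞ :=
  ⨆ i, ENNReal.ofReal (Real.exp (t * ∑ k : Fin n × Fin m, u i k.1 * v i k.2 * S k.1 k.2))

lemma measurable_expSup (u : ℕ → Fin n → ℝ) (v : ℕ → Fin m → ℝ) (t : ℝ) :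
    Measurable (expSup u v t) :=
  .iSup fun i => by fun_prop

lemma lintegral_expSup_gaussian_le {t : ℝ} (ht : 0 ≤ t) (u : ℕ → Fin n → ℝ) (v : ℕ → Fin m → ℝ)
    (hu : ∀ i, ∑ j, u i j ^ 2 = 1) (hv : ∀ i, ∑ j, v i j ^ 2 = 1) :
    ∫⁻ S, expSup u v t S ∂(Measure.pi fun _ : Fin n => _root_.stdGaussian m) ≤
      ENNReal.ofReal (Real.exp (t * (Real.sqrt n + Real.sqrt m) + t ^ 2 / 2)) := by
  have hmap := Measure.infinitePi_map_curry fun (_ : Fin n) (_ : Fin m) => gaussianReal 0 1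
  simp only [Measure.infinitePi_eq_pi] at hmap
  have hle := lintegral_iSup_exp_bilinear_le ht u v hu hv
  simp only [Fintype.card_fin] at hle
  refine le_trans (le_of_eq ?_) hle
  unfold _root_.stdGaussian
  rw [← hmap, lintegral_map (measurable_expSup u v t) (MeasurableEquiv.measurable _)]
  rfl

lemma measurePreserving_smul_columns (hm : 1 ≤ m) :
    MeasurePreserving (fun (z : (Fin n → ℝ) × (Fin n → Fin m → ℝ)) j => z.1 j • z.2 j)
      ((Measure.pi fun _ : Fin n => chiLaw m).prod (Measure.pi fun _ : Fin n => uniformSphere m))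
      (Measure.pi fun _ : Fin n => _root_.stdGaussian m) :=
  (measurePreserving_pi (fun _ : Fin n => (chiLaw m).prod (uniformSphere m))
    (fun _ => _root_.stdGaussian m) fun _ => measurePreserving_smul_chi_uniformSphere hm).comp
    (measurePreserving_arrowProdEquivProdArrow ℝ (Fin m → ℝ) (Fin n) (fun _ => chiLaw m)
      fun _ => uniformSphere m).symm

lemma ofReal_integral_le_lintegral_ofReal {Ω : Type*} [MeasurableSpace Ω] {μ : Measure Ω}
    {f : Ω → ℝ} (hf : Integrable f μ) :
    ENNReal.ofReal (∫ x, f x ∂μ) ≤ ∫⁻ x, ENNReal.ofReal (f x) ∂μ := by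
  rw [integral_eq_lintegral_pos_part_sub_lintegral_neg_part hf]
  refine (ENNReal.ofReal_le_ofReal (sub_le_self _ ENNReal.toReal_nonneg)).trans ?_
  exact ENNReal.ofReal_toReal_le

/-- Jensen's inequality for the exponential function. -/
lemma ofReal_exp_integral_le {Ω : Type*} [MeasurableSpace Ω] {μ : Measure Ω}
    [IsProbabilityMeasure μ] {f : Ω → ℝ} (hf : Integrable f μ) :
    ENNReal.ofReal (Real.exp (∫ x, f x ∂μ)) ≤ ∫⁻ x, ENNReal.ofReal (Real.exp (f x)) ∂μ := by
  set a := ∫ x, f x ∂μ with ha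
  have hi : Integrable (fun x => Real.exp a * (f x - a + 1)) μ :=
    ((hf.sub (integrable_const a)).add (integrable_const 1)).const_mul _
  have he : ∫ x, Real.exp a * (f x - a + 1) ∂μ = Real.exp a := by
    have hi' : Integrable (fun x => f x - a) μ := hf.sub (integrable_const a)
    rw [integral_const_mul, integral_add hi' (integrable_const 1),
      integral_sub hf (integrable_const a), ← ha]
    simp
  rw [← he]
  refine (ofReal_integral_le_lintegral_ofReal hi).trans
    (lintegral_mono fun x => ENNReal.ofReal_le_ofReal ?_)
  have h := mul_le_mul_of_nonneg_left (Real.add_one_le_exp (f x - a)) (Real.exp_pos a).le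
  rwa [← Real.exp_add, add_sub_cancel] at h

lemma integrable_id_chiLaw (m : ℕ) : Integrable (fun r => r) (chiLaw m) := by
  rw [chiLaw, integrable_map_measure (f := euclNorm) (g := fun r => r) aestronglyMeasurable_id
    continuous_euclNorm.measurable.aemeasurable]
  have h : ExpBounded (euclNorm : (Fin m → ℝ) → ℝ) := by
    have := expBounded_regNorm (κ := Fin m) le_rfl
    unfold regNorm at this
    simp only [zero_add] at this
    exact this
  exact h.integrable continuous_euclNorm.measurable

lemma ofReal_exp_mul_mean_le (c : Fin n → ℝ) :
    ENNReal.ofReal (Real.exp ((∫ r, r ∂(chiLaw m)) * ∑ j, c j)) ≤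
      ∫⁻ r, ENNReal.ofReal (Real.exp (∑ j, c j * r j)) ∂(Measure.pi fun _ : Fin n => chiLaw m) := by
  have hj : ∀ j, Integrable (fun r : Fin n → ℝ => c j * r j)
      (Measure.pi fun _ : Fin n => chiLaw m) := fun j =>
    ((measurePreserving_eval (fun _ : Fin n => chiLaw m) j).integrable_comp_of_integrable
      (integrable_id_chiLaw m)).const_mul _
  have he : ∀ j, ∫ r : Fin n → ℝ, r j ∂(Measure.pi fun _ : Fin n => chiLaw m) =
      ∫ r, r ∂(chiLaw m) := fun j => by
    have hmp := measurePreserving_eval (fun _ : Fin n => chiLaw m) j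
    conv_rhs => rw [← hmp.map_eq]
    rw [integral_map hmp.measurable.aemeasurable (f := fun r => r) aestronglyMeasurable_id]
  refine le_trans (le_of_eq ?_) (ofReal_exp_integral_le (integrable_finsetSum _ fun j _ => hj j))
  rw [integral_finsetSum _ fun j _ => hj j]
  simp only [integral_const_mul, he]
  rw [← Finset.sum_mul, mul_comm]

lemma lintegral_expSup_uniformSphere_le (hm : 1 ≤ m) (t : ℝ) (u : ℕ → Fin n → ℝ)
    (v : ℕ → Fin m → ℝ) :
    ∫⁻ S, expSup u v ((∫ r, r ∂(chiLaw m)) * t) S ∂(Measure.pi fun _ : Fin n => uniformSphere m) ≤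
      ∫⁻ S, expSup u v t S ∂(Measure.pi fun _ : Fin n => _root_.stdGaussian m) := by
  have hmp := measurePreserving_smul_columns (m := m) (n := n) hm
  have hmeas := measurable_expSup u v t
  have hF : Measurable fun z : (Fin n → ℝ) × (Fin n → Fin m → ℝ) =>
      expSup u v t fun j => z.1 j • z.2 j := hmeas.comp hmp.measurable
  rw [← hmp.map_eq, lintegral_map hmeas hmp.measurable, lintegral_prod_symm _ hF.aemeasurable]
  refine lintegral_mono fun S => iSup_le fun i => ?_
  set c : Fin n → ℝ := fun j => t * ∑ l, u i j * v i l * S j l with hc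
  have h1 : (∫ r, r ∂(chiLaw m)) * t * ∑ k : Fin n × Fin m, u i k.1 * v i k.2 * S k.1 k.2 =
      (∫ r, r ∂(chiLaw m)) * ∑ j, c j := by
    rw [Fintype.sum_prod_type, hc, ← Finset.mul_sum, mul_assoc]
  rw [h1]
  refine (ofReal_exp_mul_mean_le c).trans (lintegral_mono fun r => ?_)
  refine le_of_eq_of_le ?_ (le_iSup (fun i => ENNReal.ofReal (Real.exp
    (t * ∑ k : Fin n × Fin m, u i k.1 * v i k.2 * (r k.1 • S k.1) k.2))) i)
  congr 2
  rw [Fintype.sum_prod_type, Finset.mul_sum]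
  refine Finset.sum_congr rfl fun j _ => ?_
  rw [hc, mul_assoc, Finset.sum_mul]
  congr 1
  refine Finset.sum_congr rfl fun l _ => ?_
  simp only [Pi.smul_apply, smul_eq_mul]
  ring

/-- The pairs of unit vectors. -/
def unitPairs (n m : ℕ) : Set ((Fin n → ℝ) × (Fin m → ℝ)) :=
  {z | ∑ j, z.1 j ^ 2 = 1 ∧ ∑ i, z.2 i ^ 2 = 1}

lemma exists_unit_of_pos (hm : 1 ≤ m) : ∃ v : Fin m → ℝ, ∑ i, v i ^ 2 = 1 :=
  ⟨Pi.single ⟨0, hm⟩ 1, by simp [Pi.single_apply, ite_pow]⟩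

lemma exists_unit_dual (hm : 1 ≤ m) (y : Fin m → ℝ) :
    ∃ v : Fin m → ℝ, ∑ i, v i ^ 2 = 1 ∧ ∑ i, v i * y i = euclNorm y := by
  rcases (euclNorm_nonneg y).eq_or_lt with h | h
  · obtain ⟨v, hv⟩ := exists_unit_of_pos hm
    refine ⟨v, hv, ?_⟩
    have h2 : ∑ i, y i ^ 2 = 0 := by rw [← sq_euclNorm, ← h, sq, zero_mul]
    rw [Finset.sum_eq_zero_iff_of_nonneg fun _ _ => sq_nonneg _] at h2
    rw [← h]
    refine Finset.sum_eq_zero fun i hi => ?_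
    rw [pow_eq_zero_iff two_ne_zero |>.1 (h2 i hi), mul_zero]
  · refine ⟨fun i => y i / euclNorm y, ?_, ?_⟩
    · simp only [div_pow]
      rw [← Finset.sum_div, ← sq_euclNorm, div_self (by positivity)]
    · simp only [div_mul_eq_mul_div, ← sq]
      rw [← Finset.sum_div, ← sq_euclNorm, sq, mul_div_assoc, div_self h.ne', mul_one]

/-- A dense sequence of pairs of unit vectors. -/
lemma exists_dense_unitPairs (hm : 1 ≤ m) (hn : 1 ≤ n) :
    ∃ z : ℕ → unitPairs n m, DenseRange z := by
  obtain ⟨u, hu⟩ := exists_unit_of_pos hn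
  obtain ⟨v, hv⟩ := exists_unit_of_pos hm
  have : Nonempty (unitPairs n m) := ⟨⟨(u, v), hu, hv⟩⟩
  exact TopologicalSpace.exists_dense_seq _

lemma exp_specNorm_le_expSup (hm : 1 ≤ m) (hn : 1 ≤ n) {z : ℕ → unitPairs n m}
    (hz : DenseRange z) {t : ℝ} (ht : 0 < t) (S : Fin n → Fin m → ℝ) :
    ENNReal.ofReal (Real.exp (t * specNorm S)) ≤
      expSup (fun i => (z i).1.1) (fun i => (z i).1.2) t S := by
  set N := expSup (fun i => (z i).1.1) (fun i => (z i).1.2) t S with hN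
  rcases eq_or_ne N ⊤ with htop | htop
  · rw [htop]
    exact le_top
  have hall : ∀ w : unitPairs n m, ENNReal.ofReal
      (Real.exp (t * ∑ k : Fin n × Fin m, w.1.1 k.1 * w.1.2 k.2 * S k.1 k.2)) ≤ N := by
    have hclosed : IsClosed {w : unitPairs n m | ENNReal.ofReal
        (Real.exp (t * ∑ k : Fin n × Fin m, w.1.1 k.1 * w.1.2 k.2 * S k.1 k.2)) ≤ N} := by
      refine isClosed_le (ENNReal.continuous_ofReal.comp ?_) continuous_const
      fun_prop
    exact fun w => hclosed.closure_subset_iff.2 (Set.range_subset_iff.2 fun i =>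
      le_iSup (fun i => ENNReal.ofReal (Real.exp
        (t * ∑ k : Fin n × Fin m, (z i).1.1 k.1 * (z i).1.2 k.2 * S k.1 k.2))) i) (hz w)
  have hunit : ∀ u : Fin n → ℝ, euclNorm u = 1 →
      Real.exp (t * euclNorm fun i => ∑ j, S j i * u j) ≤ N.toReal := fun u hu => by
    obtain ⟨v, hv, hvy⟩ := exists_unit_dual hm fun i => ∑ j, S j i * u j
    have hu' : ∑ j, u j ^ 2 = 1 := by rw [← sq_euclNorm, hu, one_pow]
    have h := hall ⟨(u, v), hu', hv⟩
    rw [ENNReal.ofReal_le_iff_le_toReal htop] at h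
    refine le_of_eq_of_le ?_ h
    rw [← hvy, Fintype.sum_prod_type_right]
    simp only [Finset.mul_sum]
    congr 1
    refine Finset.sum_congr rfl fun i _ => Finset.sum_congr rfl fun j _ => ?_
    ring
  obtain ⟨u, hu⟩ := exists_unit_of_pos hn
  have hu1 : euclNorm u = 1 := by rw [euclNorm, hu, Real.sqrt_one]
  have hpos : 0 < N.toReal := (Real.exp_pos _).trans_le (hunit u hu1)
  have hsup : specNorm S ≤ Real.log N.toReal / t := by
    refine csSup_le ⟨_, u, hu1, rfl⟩ ?_
    rintro _ ⟨u, hu, rfl⟩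
    rw [le_div_iff₀' ht, Real.le_log_iff_exp_le hpos]
    exact hunit u hu
  rw [ENNReal.ofReal_le_iff_le_toReal htop, ← Real.le_log_iff_exp_le hpos]
  rwa [le_div_iff₀' ht] at hsup

/-- The sharper form of the tail bound, with constant one and positive parameters. -/
theorem uniformSphere_specNorm_tail_le (hm : 1 ≤ m) (hn : 1 ≤ n) {t : ℝ} (ht : 0 < t) :
    (Measure.pi fun _ : Fin n => uniformSphere m)
        {S | (Real.sqrt n + Real.sqrt m + t) / Real.sqrt ((m : ℝ) - 0.5) ≤ specNorm S} ≤
      ENNReal.ofReal (Real.exp (-t ^ 2 / 2)) := by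
  obtain ⟨z, hz⟩ := exists_dense_unitPairs hm hn
  set u : ℕ → Fin n → ℝ := fun i => (z i).1.1
  set v : ℕ → Fin m → ℝ := fun i => (z i).1.2
  set a := ∫ r, r ∂(chiLaw m) with ha
  set P := Measure.pi fun _ : Fin n => uniformSphere m
  have m1 : (1 : ℝ) ≤ m := by exact_mod_cast hm
  have hs : 0 < Real.sqrt ((m : ℝ) - 0.5) := Real.sqrt_pos.2 (by norm_num; linarith)
  have hsa : Real.sqrt ((m : ℝ) - 0.5) ≤ a := sqrt_le_integral_chiLaw hm
  have hapos : 0 < a := hs.trans_le hsa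
  set L := Real.sqrt n + Real.sqrt m + t with hL
  have hLpos : 0 < L := by positivity
  have hsub : {S | L / Real.sqrt ((m : ℝ) - 0.5) ≤ specNorm S} ⊆
      {S | ENNReal.ofReal (Real.exp (t * L)) ≤ expSup u v (a * t) S} := fun S hS => by
    refine le_trans (ENNReal.ofReal_le_ofReal (Real.exp_le_exp.2 ?_))
      (exp_specNorm_le_expSup hm hn hz (mul_pos hapos ht) S)
    have h1 : L ≤ specNorm S * Real.sqrt ((m : ℝ) - 0.5) := (div_le_iff₀ hs).1 hS
    have h2 : 0 ≤ specNorm S := (div_nonneg hLpos.le hs.le).trans hS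
    nlinarith [mul_le_mul_of_nonneg_left hsa h2]
  have hE : ENNReal.ofReal (Real.exp (t * L)) *
      P {S | ENNReal.ofReal (Real.exp (t * L)) ≤ expSup u v (a * t) S} ≤
      ENNReal.ofReal (Real.exp (t * (Real.sqrt n + Real.sqrt m) + t ^ 2 / 2)) :=
    (mul_meas_ge_le_lintegral (measurable_expSup u v (a * t)) _).trans
      ((lintegral_expSup_uniformSphere_le hm t u v).trans
        (lintegral_expSup_gaussian_le ht.le u v (fun i => (z i).2.1) fun i => (z i).2.2))
  have hexp : Real.exp (t * (Real.sqrt n + Real.sqrt m) + t ^ 2 / 2) =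
      Real.exp (t * L) * Real.exp (-t ^ 2 / 2) := by
    rw [← Real.exp_add, hL]
    ring_nf
  rw [hexp, ENNReal.ofReal_mul (Real.exp_pos _).le] at hE
  refine (measure_mono hsub).trans ?_
  exact (ENNReal.mul_le_mul_iff_right (ENNReal.ofReal_pos.2 (Real.exp_pos _)).ne'
    ENNReal.ofReal_ne_top).1 hE

end SphericalColumns

/-- Let `S` be an `m × n` random matrix whose columns are i.i.d.
uniform on the unit sphere `S^{m−1}` (modeled by the product measure on the
`n` columns).  For each `t ≥ 0`,
`P(‖S‖ ≥ (√n + √m + t)/√(m − 0.5)) ≤ 1.5 e^{−t²/2}`. -/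
theorem spherical_matrix_spectral_norm_tail
    (m n : ℕ) (hm : 1 ≤ m) (t : ℝ) (ht : 0 ≤ t) :
    (Measure.pi fun _ : Fin n => uniformSphere m)
        {S | (Real.sqrt n + Real.sqrt m + t) / Real.sqrt ((m : ℝ) - 0.5) ≤
              specNorm S}
      ≤ ENNReal.ofReal (1.5 * Real.exp (-t ^ 2 / 2)) := by
  rcases ht.eq_or_lt with rfl | ht
  · refine prob_le_one.trans ?_
    rw [← ENNReal.ofReal_one]
    exact ENNReal.ofReal_le_ofReal (by norm_num)
  rcases Nat.eq_zero_or_pos n with rfl | hn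
  · have m1 : (1 : ℝ) ≤ m := by exact_mod_cast hm
    have hs : 0 < Real.sqrt ((m : ℝ) - 0.5) := Real.sqrt_pos.2 (by norm_num; linarith)
    have hempty : {S : Fin 0 → Fin m → ℝ | (Real.sqrt (0 : ℕ) + Real.sqrt m + t) /
        Real.sqrt ((m : ℝ) - 0.5) ≤ specNorm S} = ∅ := by
      refine Set.eq_empty_of_forall_notMem fun S hS => ?_
      have h0 : specNorm S = 0 := by simp [specNorm, euclNorm]
      rw [Set.mem_ofPred_eq, h0] at hS
      have : 0 < (Real.sqrt (0 : ℕ) + Real.sqrt m + t) / Real.sqrt ((m : ℝ) - 0.5) := by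
        positivity
      linarith
    rw [hempty, measure_empty]
    exact zero_le
  · refine (uniformSphere_specNorm_tail_le hm hn ht).trans (ENNReal.ofReal_le_ofReal ?_)
    linarith [Real.exp_pos (-t ^ 2 / 2)]
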